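/- arXiv:1110.2706 — 3 statements merged into one kernel-verified Lean document; each statement's English description precedes it below -/
import Mathlib

section
/- Let M be a nonzero A-module lying in EIP_{p−1}, and let n be an integer with n ≥ (dim_k M)². Then no minimal 2n-th syzygy of M lies in EIP_{p−1}. -/
open MvPolynomial Module

set_option maxHeartbeats 1000000
set_option synthInstance.maxHeartbeats 400000

noncomputable section

/-- The defining ideal `(X^p, Y^p)` of the polynomial ring in two variables. -/
def relI (k : Type) [Field k] (p : ℕ) : Ideal (MvPolynomial (Fin 2) k) :=
  Ideal.span {(X 0 : MvPolynomial (Fin 2) k) ^ p, (X 1 : MvPolynomial (Fin 2) k) ^ p}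

/-- The algebra `A = k[X,Y]/(X^p, Y^p)`. -/
abbrev Amod (k : Type) [Field k] (p : ℕ) : Type :=
  MvPolynomial (Fin 2) k ⧸ relI k p

variable (k : Type) [Field k] (p : ℕ)

/-- `x`, the image of `X` in `A`. -/
def xA : Amod k p := Ideal.Quotient.mk (relI k p) (X 0)

/-- `y`, the image of `Y` in `A`. -/
def yA : Amod k p := Ideal.Quotient.mk (relI k p) (X 1)

/-- The maximal ideal `𝔪 = (x, y)` of `A`. -/
def mA : Ideal (Amod k p) := Ideal.span {xA k p, yA k p}

/-- A point operator: `u = α x + β y` with `(α, β) ≠ (0, 0)`. -/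
def IsPointOp (u : Amod k p) : Prop :=
  ∃ α β : k, (α ≠ 0 ∨ β ≠ 0) ∧ u = α • xA k p + β • yA k p

/-- Equal images property: `u M = 𝔪 M` for every point operator `u`. -/
def EIP (M : Type) [AddCommGroup M] [Module (Amod k p) M] : Prop :=
  ∀ u : Amod k p, IsPointOp k p u →
    LinearMap.range (LinearMap.lsmul (Amod k p) M u)
      = mA k p • (⊤ : Submodule (Amod k p) M)

/-- `M` lies in `EIP_d`: equal images property and `𝔪^d M = 0`. -/
def EIPd (d : ℕ) (M : Type) [AddCommGroup M] [Module (Amod k p) M] : Prop :=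
  EIP k p M ∧ (mA k p) ^ d • (⊤ : Submodule (Amod k p) M) = ⊥


/-- `IsMinSyz m N M`: the `A`-module `N` is a minimal `m`-th syzygy of `M`, i.e. it arises
(up to isomorphism) as the last kernel `ker(F_{m−1} → F_{m−2})` of an exact sequence
`F_{m−1} → ⋯ → F_1 → F_0 → M → 0` of finitely generated free `A`-modules `F_i` with
`ker(F_0 → M) ⊆ 𝔪F_0` and `ker(F_i → F_{i−1}) ⊆ 𝔪F_i`; equivalently, it is obtained by
`m`-fold iteration of minimal first syzygies. -/
def IsMinSyz : ℕ → ModuleCat.{0} (Amod k p) → ModuleCat.{0} (Amod k p) → Prop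
  | 0, N, M => Nonempty ((↥N) ≃ₗ[Amod k p] (↥M))
  | (m + 1), N, M => ∃ (r : ℕ) (g : (Fin r → Amod k p) →ₗ[Amod k p] M),
      Function.Surjective g ∧
      LinearMap.ker g ≤ mA k p • (⊤ : Submodule (Amod k p) (Fin r → Amod k p)) ∧
      IsMinSyz m N (ModuleCat.of (Amod k p) (↥(LinearMap.ker g)))

section Abstract

/-- Homogeneous polynomial families (in two parameters) of vectors. -/
def HomogFam {F V : Type} [Field F] [AddCommGroup V] [Module F V] : ℕ → (F → F → V) → Prop
  | 0, f => ∃ v, ∀ s t, f s t = v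
  | (d + 1), f => ∃ f₁ f₂ : F → F → V, HomogFam d f₁ ∧ HomogFam d f₂ ∧
      ∀ s t, f s t = s • f₁ s t + t • f₂ s t

variable {F : Type} [Field F]

lemma HomogFam.map {V W : Type} [AddCommGroup V] [Module F V] [AddCommGroup W] [Module F W]
    (φ : V →ₗ[F] W) : ∀ {d : ℕ} {f : F → F → V}, HomogFam d f →
      HomogFam d (fun s t => φ (f s t))
  | 0, f, ⟨v, hv⟩ => ⟨φ v, fun s t => by simp [hv]⟩
  | (d + 1), f, ⟨f₁, f₂, h₁, h₂, h⟩ =>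
      ⟨_, _, HomogFam.map φ h₁, HomogFam.map φ h₂, fun s t => by simp [h]⟩

lemma HomogFam.comp {U V W : Type} [AddCommGroup V] [Module F V] [AddCommGroup W] [Module F W]
    [AddCommGroup U] [Module F U] {e : ℕ} {f : F → F → (U →ₗ[F] V)} (hf : HomogFam e f) :
    ∀ {d : ℕ} {g : F → F → (V →ₗ[F] W)}, HomogFam d g →
      HomogFam (e + d) (fun s t => (g s t).comp (f s t))
  | 0, g, ⟨v, hv⟩ => by
      simp only [hv, add_zero]
      exact hf.map (LinearMap.llcomp F U V W v)
  | (d + 1), g, ⟨f₁, f₂, h₁, h₂, h⟩ =>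
      ⟨_, _, HomogFam.comp hf h₁, HomogFam.comp hf h₂, fun s t => by
        ext x; simp [h]⟩

lemma HomogFam.smul_hom {V : Type} [AddCommGroup V] [Module F V] (c : F) :
    ∀ {d : ℕ} {f : F → F → V}, HomogFam d f → ∀ s t, f (c * s) (c * t) = c ^ d • f s t
  | 0, f, ⟨v, hv⟩, s, t => by simp [hv]
  | (d + 1), f, ⟨f₁, f₂, h₁, h₂, h⟩, s, t => by
      rw [h, h, HomogFam.smul_hom c h₁, HomogFam.smul_hom c h₂]
      simp only [smul_add, smul_smul]
      congr 2 <;> ring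

lemma HomogFam.poly : ∀ {d : ℕ} {f : F → F → F}, HomogFam d f →
    (∃ P : Polynomial F, ∀ t, f 1 t = P.eval t) ∧ (∃ P : Polynomial F, ∀ s, f s 1 = P.eval s)
  | 0, f, ⟨v, hv⟩ => ⟨⟨Polynomial.C v, by simp [hv]⟩, ⟨Polynomial.C v, by simp [hv]⟩⟩
  | (d + 1), f, ⟨f₁, f₂, h₁, h₂, h⟩ => by
      obtain ⟨⟨P₁, hP₁⟩, ⟨Q₁, hQ₁⟩⟩ := HomogFam.poly h₁
      obtain ⟨⟨P₂, hP₂⟩, ⟨Q₂, hQ₂⟩⟩ := HomogFam.poly h₂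
      exact ⟨⟨P₁ + Polynomial.X * P₂, fun t => by simp [h, hP₁, hP₂]⟩,
        ⟨Polynomial.X * Q₁ + Q₂, fun t => by simp [h, hQ₁, hQ₂]⟩⟩

/-- Determinant argument: a homogeneous family of endomorphisms of positive degree on a nonzero
space degenerates somewhere away from the origin. -/
lemma HomogFam.exists_not_inj [IsAlgClosed F] {V : Type} [AddCommGroup V] [Module F V]
    [FiniteDimensional F V] [Nontrivial V] {d : ℕ} (hd : 0 < d) {f : F → F → (V →ₗ[F] V)}
    (hf : HomogFam d f) : ∃ s t : F, (s ≠ 0 ∨ t ≠ 0) ∧ ¬ Function.Injective (f s t) := by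
  by_contra! hcon
  have hdet : ∀ s t, (s ≠ 0 ∨ t ≠ 0) → LinearMap.det (f s t) ≠ 0 := by
    intro s t h h0
    have h1 := hcon s t h
    have h2 : LinearMap.ker (f s t) = ⊥ := LinearMap.ker_eq_bot.mpr h1
    have := LinearMap.bot_lt_ker_of_det_eq_zero h0
    rw [h2] at this
    exact lt_irrefl _ this
  let b := Module.finBasis F V
  have hent : ∀ i j, HomogFam d (fun s t => LinearMap.toMatrix b b (f s t) i j) := fun i j =>
    hf.map ((Matrix.entryLinearMap F F i j).comp (LinearMap.toMatrix b b).toLinearMap)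
  choose P hP using fun i j => (hent i j).poly.1
  choose Q hQ using fun i j => (hent i j).poly.2
  let PP := (Matrix.of P).det
  let QQ := (Matrix.of Q).det
  have hPP : ∀ t, LinearMap.det (f 1 t) = PP.eval t := by
    intro t
    rw [← LinearMap.det_toMatrix b]
    change _ = Polynomial.evalRingHom t (Matrix.of P).det
    rw [RingHom.map_det]
    congr 1
    ext i j
    simp [hP]
  have hQQ : ∀ t, LinearMap.det (f t 1) = QQ.eval t := by
    intro t
    rw [← LinearMap.det_toMatrix b]
    change _ = Polynomial.evalRingHom t (Matrix.of Q).det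
    rw [RingHom.map_det]
    congr 1
    ext i j
    simp [hQ]
  have hdeg : PP.degree = 0 := by
    by_contra h
    obtain ⟨t, ht⟩ := IsAlgClosed.exists_root PP h
    exact hdet 1 t (by simp) (by rw [hPP]; exact ht)
  obtain ⟨c, hc⟩ : ∃ c, PP = Polynomial.C c := ⟨_, Polynomial.eq_C_of_degree_eq_zero hdeg⟩
  have hr : 0 < finrank F V := Module.finrank_pos
  have key : ∀ s, s ≠ 0 → QQ.eval s = (Polynomial.C c * Polynomial.X ^ (d * finrank F V)).eval s := by
    intro s hs
    have h1 := hf.smul_hom s 1 s⁻¹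
    rw [mul_one, mul_inv_cancel₀ hs] at h1
    rw [← hQQ, h1, LinearMap.det_smul, hPP, hc]
    simp [pow_mul, mul_comm]
  have hEq : QQ = Polynomial.C c * Polynomial.X ^ (d * finrank F V) := by
    haveI : Infinite F := IsAlgClosed.instInfinite
    apply Polynomial.eq_of_infinite_eval_eq
    apply Set.Infinite.mono (s := {0}ᶜ)
    · intro s hs; exact key s hs
    · exact (Set.finite_singleton (0:F)).infinite_compl
  have h0 := hdet 0 1 (by simp)
  rw [hQQ, hEq] at h0
  apply h0
  have : d * finrank F V ≠ 0 := (Nat.mul_pos hd hr).ne'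
  simp [this]

variable {A : Type} [CommRing A] [Algebra F A]

/-- `φ` induces a bijection `ker u^q / im u → ker u^q / im u`. -/
structure GoodMap (q : ℕ) (u : A) {M N : Type} [AddCommGroup M] [Module A M] [Module F M]
    [AddCommGroup N] [Module A N] [Module F N] (φ : M →ₗ[F] N) : Prop where
  ker : ∀ l, u ^ q • l = 0 → u ^ q • φ l = 0
  inj : ∀ l, u ^ q • l = 0 → (∃ n, φ l = u • n) → ∃ l', l = u • l'
  wd : ∀ l, ∃ n, φ (u • l) = u • n
  surj : ∀ n, u ^ q • n = 0 → ∃ l, u ^ q • l = 0 ∧ ∃ n', φ l = n + u • n'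

lemma GoodMap.comp {q : ℕ} {u : A} {L M N : Type} [AddCommGroup M] [Module A M] [Module F M]
    [AddCommGroup N] [Module A N] [Module F N] [AddCommGroup L] [Module A L] [Module F L]
    {φ : L →ₗ[F] M} {ψ : M →ₗ[F] N} (h1 : GoodMap q u φ) (h2 : GoodMap q u ψ) :
    GoodMap q u (ψ.comp φ) where
  ker l hl := h2.ker _ (h1.ker l hl)
  inj l hl h := h1.inj l hl (h2.inj _ (h1.ker l hl) h)
  wd l := by
    obtain ⟨m, hm⟩ := h1.wd l
    obtain ⟨n, hn⟩ := h2.wd m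
    exact ⟨n, by simp [hm, hn]⟩
  surj n hn := by
    obtain ⟨m, hm, n', hn'⟩ := h2.surj n hn
    obtain ⟨l, hl, m', hm'⟩ := h1.surj m hm
    obtain ⟨n'', hn''⟩ := h2.wd m'
    exact ⟨l, hl, n' + n'', by simp [hm', hn', hn'', add_assoc]⟩

/-- The two-step syzygy comparison map is good. -/
lemma goodMap_step {q : ℕ} {u : A} (hu : u ^ (q + 1) = 0)
    {L E K E₁ K₂ : Type} [AddCommGroup L] [Module A L] [Module F L]
    [AddCommGroup E] [Module A E] [Module F E] [AddCommGroup K] [Module A K] [Module F K]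
    [AddCommGroup E₁] [Module A E₁] [Module F E₁] [AddCommGroup K₂] [Module A K₂] [Module F K₂]
    [IsScalarTower F A E] [IsScalarTower F A E₁]
    (g : E →ₗ[A] L) (i : K →ₗ[A] E) (h : E₁ →ₗ[A] K) (j : K₂ →ₗ[A] E₁)
    (hi : Function.Injective i) (hj : Function.Injective j)
    (hgi : ∀ e, g e = 0 ↔ ∃ a, i a = e) (hhj : ∀ e, h e = 0 ↔ ∃ a, j a = e)
    (hE : ∀ e : E, u ^ q • e = 0 → ∃ e', e = u • e')
    (hE' : ∀ e : E, u • e = 0 → ∃ e', e = u ^ q • e')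
    (hE₁ : ∀ e : E₁, u ^ q • e = 0 → ∃ e', e = u • e')
    (hE₁' : ∀ e : E₁, u • e = 0 → ∃ e', e = u ^ q • e')
    (σ : L →ₗ[F] E) (hσ : ∀ l, g (σ l) = l) (κ : E →ₗ[F] K) (hκ : ∀ a, κ (i a) = a)
    (τ : K →ₗ[F] E₁) (hτ : ∀ l, h (τ l) = l) (ρ : E₁ →ₗ[F] K₂) (hρ : ∀ a, ρ (j a) = a) :
    GoodMap q u (ρ ∘ₗ Algebra.lsmul F F E₁ u ∘ₗ τ ∘ₗ κ ∘ₗ Algebra.lsmul F F E (u ^ q) ∘ₗ σ) := by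
  have hgi0 : ∀ a, g (i a) = 0 := fun a => (hgi _).2 ⟨a, rfl⟩
  have hhj0 : ∀ a, h (j a) = 0 := fun a => (hhj _).2 ⟨a, rfl⟩
  have huu : ∀ e : E, u • (u ^ q • e) = 0 := fun e => by rw [smul_smul, ← pow_succ', hu, zero_smul]
  have huu1 : ∀ e : E₁, u • (u ^ q • e) = 0 := fun e => by
    rw [smul_smul, ← pow_succ', hu, zero_smul]
  have huu1' : ∀ e : E₁, u ^ q • (u • e) = 0 := fun e => by
    rw [smul_smul, ← pow_succ, hu, zero_smul]
  have huu' : ∀ e : E, u ^ q • (u • e) = 0 := fun e => by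
    rw [smul_smul, ← pow_succ, hu, zero_smul]
  -- description of the map
  have desc : ∀ l, u ^ q • l = 0 → ∃ w n, i w = u ^ q • σ l ∧ j n = u • τ w ∧
      (ρ ∘ₗ Algebra.lsmul F F E₁ u ∘ₗ τ ∘ₗ κ ∘ₗ Algebra.lsmul F F E (u ^ q) ∘ₗ σ) l = n := by
    intro l hl
    obtain ⟨w, hw⟩ := (hgi (u ^ q • σ l)).1 (by simp [hσ, hl])
    have huw : u • w = 0 := hi (by rw [map_smul, hw, huu, map_zero])
    obtain ⟨n, hn⟩ := (hhj (u • τ w)).1 (by simp [hτ, huw])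
    refine ⟨w, n, hw, hn, ?_⟩
    change ρ (u • τ (κ (u ^ q • σ l))) = n
    rw [← hw, hκ, ← hn, hρ]
  generalize (ρ ∘ₗ Algebra.lsmul F F E₁ u ∘ₗ τ ∘ₗ κ ∘ₗ Algebra.lsmul F F E (u ^ q) ∘ₗ σ) = φ at desc ⊢
  constructor
  · intro l hl
    obtain ⟨w, n, hw, hn, h⟩ := desc l hl
    rw [h]
    apply hj
    rw [map_smul, hn, huu1', map_zero]
  · rintro l hl ⟨n', hn'⟩
    obtain ⟨w, n, hw, hn, h1⟩ := desc l hl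
    rw [h1] at hn'
    subst hn'
    obtain ⟨f, hf⟩ := hE₁' (τ w - j n') (by rw [smul_sub, ← hn, map_smul, sub_self])
    have hwf : w = u ^ q • h f := by
      have := congrArg h hf
      simpa [hτ, hhj0] using this
    obtain ⟨f', hf'⟩ := hE (σ l - i (h f)) (by
      rw [smul_sub, ← hw, hwf, map_smul, sub_self])
    refine ⟨g f', ?_⟩
    have := congrArg g hf'
    simpa [hσ, hgi0] using this
  · intro l
    have hl0 : u ^ q • (u • l) = 0 := by
      have := congrArg g (huu' (σ l))
      simpa [hσ] using this
    obtain ⟨w, n, hw, hn, h1⟩ := desc (u • l) hl0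
    obtain ⟨a, ha⟩ := (hgi (σ (u • l) - u • σ l)).1 (by simp [hσ])
    have hwa : w = u ^ q • a := hi (by
      rw [map_smul, hw, ha, smul_sub, huu', sub_zero])
    obtain ⟨n', hn'⟩ := (hhj (τ w - u ^ q • τ a)).1 (by simp [hτ, hwa])
    refine ⟨n', ?_⟩
    rw [h1]
    apply hj
    rw [map_smul, hn, hn', smul_sub, huu1, sub_zero]
  · intro n hn
    obtain ⟨f1, hf1⟩ := hE₁ (j n) (by rw [← map_smul, hn, map_zero])
    obtain ⟨f0, hf0⟩ := hE' (i (h f1)) (by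
      rw [← map_smul, ← map_smul, ← hf1, hhj0, map_zero])
    have hl0 : u ^ q • g f0 = 0 := by rw [← map_smul, ← hf0, hgi0]
    refine ⟨g f0, hl0, ?_⟩
    obtain ⟨w, m, hw, hm, h1⟩ := desc _ hl0
    obtain ⟨a, ha⟩ := (hgi (σ (g f0) - f0)).1 (by simp [hσ])
    have hwa : w = h f1 + u ^ q • a := hi (by
      rw [map_add, map_smul, hw, ha, smul_sub, hf0]; abel)
    obtain ⟨n', hn'⟩ := (hhj (τ w - f1 - u ^ q • τ a)).1 (by simp [hτ, hwa])
    refine ⟨n', ?_⟩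
    rw [h1]
    apply hj
    rw [map_add, map_smul, hm, hn', smul_sub, smul_sub, huu1, hf1]
    abel

end Abstract

lemma linForm_prime {α β : k} (h : α ≠ 0 ∨ β ≠ 0) :
    Prime (C α * X 0 + C β * X 1 : MvPolynomial (Fin 2) k) := by
  rw [← irreducible_iff_prime]
  have c0 : coeff (Finsupp.single 0 1) (C α * X 0 + C β * X 1 : MvPolynomial (Fin 2) k) = α := by
    simp [coeff_C_mul, coeff_X, Finsupp.single_left_inj]
  have c1 : coeff (Finsupp.single 1 1) (C α * X 0 + C β * X 1 : MvPolynomial (Fin 2) k) = β := by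
    simp [coeff_C_mul, coeff_X, Finsupp.single_left_inj]
  apply irreducible_of_totalDegree_eq_one
  · apply le_antisymm
    · refine (totalDegree_add _ _).trans (max_le ?_ ?_) <;>
      · refine (totalDegree_mul _ _).trans ?_
        simp
    · rcases h with h | h
      · have := le_totalDegree (p := (C α * X 0 + C β * X 1 : MvPolynomial (Fin 2) k))
          (s := Finsupp.single 0 1) (by rw [MvPolynomial.mem_support_iff, c0]; exact h)
        simpa using this
      · have := le_totalDegree (p := (C α * X 0 + C β * X 1 : MvPolynomial (Fin 2) k))
          (s := Finsupp.single 1 1) (by rw [MvPolynomial.mem_support_iff, c1]; exact h)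
        simpa using this
  · intro x hx
    rcases h with h | h
    · exact isUnit_of_dvd_unit (c0 ▸ hx (Finsupp.single 0 1)) h.isUnit
    · exact isUnit_of_dvd_unit (c1 ▸ hx (Finsupp.single 1 1)) h.isUnit

lemma linForm_pow [Fact p.Prime] [CharP k p] (α β : k) :
    (C α * X 0 + C β * X 1 : MvPolynomial (Fin 2) k) ^ p
      = C (α ^ p) * X 0 ^ p + C (β ^ p) * X 1 ^ p := by
  rw [add_pow_char, mul_pow, mul_pow, C_pow, C_pow]

lemma pointOp_eq (α β : k) : α • xA k p + β • yA k p =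
    Ideal.Quotient.mk (relI k p) (C α * X 0 + C β * X 1) := by
  rw [← smul_eq_C_mul, ← smul_eq_C_mul]
  rfl

lemma pointOp_pow [Fact p.Prime] [CharP k p] (α β : k) :
    (α • xA k p + β • yA k p) ^ p = 0 := by
  rw [pointOp_eq, ← map_pow, linForm_pow, Ideal.Quotient.eq_zero_iff_mem]
  exact Ideal.add_mem _ (Ideal.mul_mem_left _ _ (Ideal.subset_span (by simp)))
    (Ideal.mul_mem_left _ _ (Ideal.subset_span (by simp)))

/-- In a domain, dividing by a prime power modulo `(U^p, Z^p)`. -/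
lemma div_aux {S : Type} [CommRing S] [IsDomain S] {U Z f a b : S} (hU : Prime U) (hZ : ¬ U ∣ Z)
    {q r : ℕ} (h : U ^ q * f = a * U ^ (q + r) + b * Z ^ (q + r)) :
    ∃ c, f = a * U ^ r + c * Z ^ (q + r) := by
  have hd : U ^ q ∣ Z ^ (q + r) * b := ⟨f - a * U ^ r, by linear_combination -h⟩
  obtain ⟨c, hc⟩ := hU.pow_dvd_of_dvd_mul_left q (fun h' => hZ (hU.dvd_of_dvd_pow h')) hd
  refine ⟨c, mul_left_cancel₀ (pow_ne_zero q hU.ne_zero) ?_⟩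
  rw [h, hc]; ring

lemma pointOp_exact [Fact p.Prime] [CharP k p] {α β : k} (h : α ≠ 0 ∨ β ≠ 0) {q r : ℕ}
    (hqr : q + r = p) (f : Amod k p) (hf : (α • xA k p + β • yA k p) ^ q * f = 0) :
    ∃ f', f = (α • xA k p + β • yA k p) ^ r * f' := by
  obtain ⟨f, rfl⟩ := Ideal.Quotient.mk_surjective f
  rw [pointOp_eq] at hf ⊢
  rw [← map_pow, ← map_mul, Ideal.Quotient.eq_zero_iff_mem, relI, Ideal.mem_span_pair] at hf
  obtain ⟨a, b, hab⟩ := hf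
  have hU := linForm_prime k h
  have hpow := linForm_pow k p α β
  have hx : Ideal.Quotient.mk (relI k p) (X 0) ^ p = 0 := by
    rw [← map_pow, Ideal.Quotient.eq_zero_iff_mem]; exact Ideal.subset_span (by simp)
  have hy : Ideal.Quotient.mk (relI k p) (X 1) ^ p = 0 := by
    rw [← map_pow, Ideal.Quotient.eq_zero_iff_mem]; exact Ideal.subset_span (by simp)
  by_cases hα : α = 0
  · have hβ : β ≠ 0 := h.resolve_left (by simpa using hα)
    have hZ : ¬ (C α * X 0 + C β * X 1 : MvPolynomial (Fin 2) k) ∣ X 0 := by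
      rintro ⟨e, he⟩
      have := congrArg (MvPolynomial.eval ![1, 0]) he
      simp [hα] at this
    have hinv : (C (β ^ p)⁻¹ * C (β ^ p) : MvPolynomial (Fin 2) k) = 1 := by
      rw [← C_mul, inv_mul_cancel₀ (pow_ne_zero _ hβ), C_1]
    obtain ⟨c, hc⟩ := div_aux (q := q) (r := r) (f := f) (a := b * C (β ^ p)⁻¹)
      (b := a - b * C (β ^ p)⁻¹ * C (α ^ p)) hU hZ (by
        rw [hqr, hpow, ← hab]; linear_combination (-b * X 1 ^ p) * hinv)
    rw [hc]
    refine ⟨Ideal.Quotient.mk _ (b * C (β ^ p)⁻¹), ?_⟩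
    rw [map_add, map_mul, map_mul _ c, map_pow, map_pow, hqr, hx, mul_zero, add_zero, mul_comm]
  · have hZ : ¬ (C α * X 0 + C β * X 1 : MvPolynomial (Fin 2) k) ∣ X 1 := by
      rintro ⟨e, he⟩
      have := congrArg (MvPolynomial.eval ![-β / α, 1]) he
      simp [mul_div_cancel₀, hα] at this
    have hinv : (C (α ^ p)⁻¹ * C (α ^ p) : MvPolynomial (Fin 2) k) = 1 := by
      rw [← C_mul, inv_mul_cancel₀ (pow_ne_zero _ hα), C_1]
    obtain ⟨c, hc⟩ := div_aux (q := q) (r := r) (f := f) (a := a * C (α ^ p)⁻¹)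
      (b := b - a * C (α ^ p)⁻¹ * C (β ^ p)) hU hZ (by
        rw [hqr, hpow, ← hab]; linear_combination (-a * X 0 ^ p) * hinv)
    rw [hc]
    refine ⟨Ideal.Quotient.mk _ (a * C (α ^ p)⁻¹), ?_⟩
    rw [map_add, map_mul, map_mul _ c, map_pow, map_pow, hqr, hy, mul_zero, add_zero, mul_comm]

lemma free_exact [Fact p.Prime] [CharP k p] {α β : k} (h : α ≠ 0 ∨ β ≠ 0) {q r : ℕ}
    (hqr : q + r = p) {m : ℕ} (f : Fin m → Amod k p)
    (hf : (α • xA k p + β • yA k p) ^ q • f = 0) :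
    ∃ f', f = (α • xA k p + β • yA k p) ^ r • f' := by
  choose f' hf' using fun i => pointOp_exact k p h hqr (f i) (congrFun hf i)
  exact ⟨f', funext hf'⟩

lemma lsmul_fam (E : Type) [AddCommGroup E] [Module (Amod k p) E] [Module k E]
    [IsScalarTower k (Amod k p) E] (q : ℕ) :
    HomogFam q (fun s t : k => (Algebra.lsmul k k E ((s • xA k p + t • yA k p) ^ q) : E →ₗ[k] E)) := by
  have key : HomogFam q (fun s t : k => (s • xA k p + t • yA k p) ^ q) := by
    induction q with
    | zero => exact ⟨1, by simp⟩
    | succ q ih =>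
      refine ⟨_, _, ih.map (LinearMap.mulLeft k (xA k p)), ih.map (LinearMap.mulLeft k (yA k p)), ?_⟩
      intro s t
      simp only [LinearMap.mulLeft_apply, pow_succ', add_mul, smul_mul_assoc]
  exact key.map (Algebra.lsmul k k E).toLinearMap

lemma exists_fam [Fact p.Prime] [CharP k p] : ∀ (n : ℕ) (M N : Type)
    [AddCommGroup M] [Module (Amod k p) M] [Module k M] [IsScalarTower k (Amod k p) M]
    [AddCommGroup N] [Module (Amod k p) N] [Module k N] [IsScalarTower k (Amod k p) N],
    IsMinSyz k p (2 * n) (ModuleCat.of (Amod k p) N) (ModuleCat.of (Amod k p) M) →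
    ∃ Φ : k → k → (M →ₗ[k] N), HomogFam (n * p) Φ ∧ ∀ s t : k, (s ≠ 0 ∨ t ≠ 0) →
      GoodMap (p - 1) (s • xA k p + t • yA k p) (Φ s t) := by
  have hp1 : p - 1 + 1 = p := Nat.sub_add_cancel (Fact.out : p.Prime).one_le
  intro n
  induction n with
  | zero =>
    intro M N _ _ _ _ _ _ _ _ h
    obtain ⟨e⟩ : Nonempty (N ≃ₗ[Amod k p] M) := h
    refine ⟨fun _ _ => (e.symm.toLinearMap.restrictScalars k), ?_, ?_⟩
    · rw [Nat.zero_mul]; exact ⟨_, fun _ _ => rfl⟩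
    · intro s t _
      constructor
      · intro l hl
        simp [← map_smul, hl]
      · rintro l hl ⟨n, hn⟩
        refine ⟨e n, ?_⟩
        have := congrArg e hn
        simpa using this
      · intro l
        exact ⟨e.symm l, by simp⟩
      · intro n hn
        exact ⟨e n, by rw [← map_smul, hn, map_zero], 0, by simp⟩
  | succ n ih =>
    intro M N _ _ _ _ _ _ _ _ h
    rw [show 2 * (n + 1) = 2 * n + 1 + 1 by ring] at h
    obtain ⟨r, g, hg, -, r', g', hg', -, hrec⟩ := h
    change (Fin r → Amod k p) →ₗ[Amod k p] M at g
    change (Fin r' → Amod k p) →ₗ[Amod k p] (LinearMap.ker g) at g'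
    obtain ⟨Ψ, hΨ, hΨg⟩ := ih (LinearMap.ker g') N hrec
    obtain ⟨σ, hσ⟩ := (g.restrictScalars k).exists_rightInverse_of_surjective
      (LinearMap.range_eq_top.2 hg)
    obtain ⟨τ, hτ⟩ := (g'.restrictScalars k).exists_rightInverse_of_surjective
      (LinearMap.range_eq_top.2 hg')
    obtain ⟨κ, hκ⟩ := ((LinearMap.ker g).subtype.restrictScalars k).exists_leftInverse_of_injective
      (LinearMap.ker_eq_bot.2 Subtype.val_injective)
    obtain ⟨ρ, hρ⟩ := ((LinearMap.ker g').subtype.restrictScalars k).exists_leftInverse_of_injective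
      (LinearMap.ker_eq_bot.2 Subtype.val_injective)
    let Θ : k → k → (M →ₗ[k] (LinearMap.ker g')) := fun s t =>
      ρ ∘ₗ Algebra.lsmul k k _ (s • xA k p + t • yA k p) ∘ₗ τ ∘ₗ κ ∘ₗ
        Algebra.lsmul k k _ ((s • xA k p + t • yA k p) ^ (p - 1)) ∘ₗ σ
    refine ⟨fun s t => (Ψ s t).comp (Θ s t), ?_, ?_⟩
    · rw [show (n + 1) * p = p + n * p by ring]
      refine HomogFam.comp ?_ hΨ
      have h0 : HomogFam 0 (fun _ _ : k => σ) := ⟨_, fun _ _ => rfl⟩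
      have h1 := h0.comp (lsmul_fam k p (Fin r → Amod k p) (p - 1))
      have h2 := (h1.map (LinearMap.llcomp k M _ _ (τ ∘ₗ κ))).comp
        (lsmul_fam k p (Fin r' → Amod k p) 1)
      have hρ0 : HomogFam 0 (fun _ _ : k => ρ) := ⟨_, fun _ _ => rfl⟩
      have h3 := h2.comp hρ0
      rw [zero_add, hp1] at h3
      simp only [pow_one] at h3
      exact h3
    · intro s t hst
      refine GoodMap.comp ?_ (hΨg s t hst)
      refine goodMap_step (by rw [hp1]; exact pointOp_pow k p s t) g (LinearMap.ker g).subtype g'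
        (LinearMap.ker g').subtype Subtype.val_injective Subtype.val_injective ?_ ?_ ?_ ?_ ?_ ?_
        σ (fun l => LinearMap.congr_fun hσ l) κ (fun l => LinearMap.congr_fun hκ l)
        τ (fun l => LinearMap.congr_fun hτ l) ρ (fun l => LinearMap.congr_fun hρ l)
      · intro e; simp
      · intro e; simp
      · intro e he
        simpa using free_exact k p hst (q := p - 1) (r := 1) hp1 e he
      · intro e he
        exact free_exact k p hst (q := 1) (r := p - 1) (by omega) e (by simpa using he)
      · intro e he
        simpa using free_exact k p hst (q := p - 1) (r := 1) hp1 e he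
      · intro e he
        exact free_exact k p hst (q := 1) (r := p - 1) (by omega) e (by simpa using he)

lemma EIPd.mem_iff {d : ℕ} {M : Type} [AddCommGroup M] [Module (Amod k p) M]
    (h : EIPd k p d M) {s t : k} (hst : s ≠ 0 ∨ t ≠ 0) (l : M) :
    l ∈ mA k p • (⊤ : Submodule (Amod k p) M) ↔ ∃ l', l = (s • xA k p + t • yA k p) • l' := by
  rw [← h.1 _ ⟨s, t, hst, rfl⟩]
  constructor
  · rintro ⟨l', h'⟩; exact ⟨l', h'.symm⟩
  · rintro ⟨l', h'⟩; exact ⟨l', h'.symm⟩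

lemma EIPd.pow_smul {d : ℕ} {M : Type} [AddCommGroup M] [Module (Amod k p) M]
    (h : EIPd k p d M) (s t : k) (l : M) : (s • xA k p + t • yA k p) ^ d • l = 0 := by
  have : (s • xA k p + t • yA k p) ^ d • l ∈ (mA k p) ^ d • (⊤ : Submodule (Amod k p) M) := by
    apply Submodule.smul_mem_smul ?_ Submodule.mem_top
    apply Ideal.pow_mem_pow
    apply Ideal.add_mem
    · exact Submodule.smul_of_tower_mem _ s (Ideal.subset_span (by simp))
    · exact Submodule.smul_of_tower_mem _ t (Ideal.subset_span (by simp))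
  rw [h.2] at this
  simpa using this

/-- if `M ≠ 0` lies in `EIP_{p−1}` and `n ≥ (dim_k M)²`, then no minimal
`2n`-th syzygy of `M` lies in `EIP_{p−1}`. -/
theorem minSyz_not_EIPd_of_large_shift
    [IsAlgClosed k] [Fact p.Prime] [CharP k p]
    (M : Type) [AddCommGroup M] [Module (Amod k p) M]
    [Module k M] [IsScalarTower k (Amod k p) M] [FiniteDimensional k M]
    (hM : Nontrivial M) (hE : EIPd k p (p - 1) M)
    (n : ℕ) (hn : (finrank k M) ^ 2 ≤ n) :
    ∀ (N : Type) [AddCommGroup N] [Module (Amod k p) N],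
      IsMinSyz k p (2 * n) (ModuleCat.of (Amod k p) N) (ModuleCat.of (Amod k p) M) →
      ¬ EIPd k p (p - 1) N := by
  intro N _ _ hsyz hN
  letI : Module k N := Module.compHom N (algebraMap k (Amod k p))
  haveI : IsScalarTower k (Amod k p) N := ⟨fun a b x => by
    change (a • b) • x = (algebraMap k (Amod k p) a) • (b • x)
    rw [Algebra.smul_def a b, mul_smul]⟩
  obtain ⟨Φ, hΦ, hgood⟩ := exists_fam k p n M N hsyz
  let mM := (mA k p • (⊤ : Submodule (Amod k p) M)).restrictScalars k
  let mN := (mA k p • (⊤ : Submodule (Amod k p) N)).restrictScalars k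
  have hmM : ∀ {s t : k}, (s ≠ 0 ∨ t ≠ 0) → ∀ l, l ∈ mM ↔ ∃ l', l = (s • xA k p + t • yA k p) • l' :=
    fun hst l => EIPd.mem_iff k p hE hst l
  have hmN : ∀ {s t : k}, (s ≠ 0 ∨ t ≠ 0) → ∀ l, l ∈ mN ↔ ∃ l', l = (s • xA k p + t • yA k p) • l' :=
    fun hst l => EIPd.mem_iff k p hN hst l
  obtain ⟨ρ, hρ⟩ := mM.mkQ.exists_rightInverse_of_surjective (Submodule.range_mkQ _)
  have hρ' : ∀ v, mM.mkQ (ρ v) = v := fun v => LinearMap.congr_fun hρ v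
  let Ψ : k → k → ((M ⧸ mM) →ₗ[k] (N ⧸ mN)) := fun s t => mN.mkQ ∘ₗ Φ s t ∘ₗ ρ
  have hΨ : HomogFam (n * p) Ψ := by
    have h0 : HomogFam 0 (fun _ _ : k => ρ) := ⟨_, fun _ _ => rfl⟩
    have := (h0.comp hΦ).map (LinearMap.llcomp k _ _ _ mN.mkQ)
    rw [zero_add] at this
    exact this
  have hinj : ∀ s t : k, (s ≠ 0 ∨ t ≠ 0) → Function.Injective (Ψ s t) := by
    intro s t hst
    rw [injective_iff_map_eq_zero]
    intro v hv
    have h1 : Φ s t (ρ v) ∈ mN := (Submodule.Quotient.mk_eq_zero _).1 hv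
    have h2 := (hgood s t hst).inj (ρ v) (EIPd.pow_smul k p hE s t _) ((hmN hst _).1 h1)
    rw [← hρ' v]
    exact (Submodule.Quotient.mk_eq_zero _).2 ((hmM hst _).2 h2)
  have hsurj : ∀ s t : k, (s ≠ 0 ∨ t ≠ 0) → Function.Surjective (Ψ s t) := by
    intro s t hst v
    obtain ⟨n, rfl⟩ := mN.mkQ_surjective v
    obtain ⟨l, -, n', hl⟩ := (hgood s t hst).surj n (EIPd.pow_smul k p hN s t _)
    refine ⟨mM.mkQ l, ?_⟩
    change mN.mkQ (Φ s t (ρ (mM.mkQ l))) = mN.mkQ n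
    have h1 : ρ (mM.mkQ l) - l ∈ mM := (Submodule.Quotient.eq _).1 (hρ' (mM.mkQ l))
    obtain ⟨l', hl'⟩ := (hmM hst _).1 h1
    obtain ⟨n'', hn''⟩ := (hgood s t hst).wd l'
    apply (Submodule.Quotient.eq _).2
    refine (hmN hst _).2 ⟨n' + n'', ?_⟩
    rw [← hl', map_sub] at hn''
    rw [smul_add, ← hn'', hl]
    abel
  let e := LinearEquiv.ofBijective (Ψ 1 0) ⟨hinj 1 0 (by simp), hsurj 1 0 (by simp)⟩
  have hnt : Nontrivial (M ⧸ mM) := by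
    rw [Submodule.Quotient.nontrivial_iff]
    intro htop
    have h1 : mA k p • (⊤ : Submodule (Amod k p) M) = ⊤ := by
      rw [eq_top_iff]
      intro x _
      have : x ∈ mM := htop ▸ Submodule.mem_top
      exact this
    have h2 : ∀ d, (mA k p) ^ d • (⊤ : Submodule (Amod k p) M) = ⊤ := by
      intro d
      induction d with
      | zero => simp
      | succ d ih => rw [pow_succ, Submodule.mul_smul, h1, ih]
    have h3 := hE.2
    rw [h2] at h3
    exact top_ne_bot h3
  have hn0 : 0 < n * p := by
    have h1 : 0 < finrank k M := Module.finrank_pos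
    have h2 : 0 < n := lt_of_lt_of_le (pow_pos h1 2) hn
    exact Nat.mul_pos h2 (Fact.out : p.Prime).pos
  obtain ⟨s, t, hst, hni⟩ := (hΨ.map (LinearMap.llcomp k (M ⧸ mM) _ _ e.symm.toLinearMap)).exists_not_inj hn0
  exact hni (e.symm.injective.comp (hinj s t hst))

end
end

section
/- Let p ≥ 3 and let M be a nonzero A-module lying in EIP_{p−2}. Then no minimal second syzygy of M has the equal images property, and no minimal second cosyzygy of M has the equal images property. -/
open MvPolynomial Module

set_option maxHeartbeats 1000000
set_option synthInstance.maxHeartbeats 400000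

noncomputable section

variable (k : Type) [Field k] (p : ℕ)

/-- A submodule `S ⊆ M` is essential if it intersects every nonzero submodule
nontrivially. -/
def IsEssentialSub {M : Type} [AddCommGroup M] [Module (Amod k p) M]
    (S : Submodule (Amod k p) M) : Prop :=
  ∀ T : Submodule (Amod k p) M, T ⊓ S = ⊥ → T = ⊥

/-- `N` is a minimal second cosyzygy of `M`: there is an exact sequence
`0 → M → F_0 → F_1 → N → 0` with `F_0, F_1` finitely generated free, `M` essential
in `F_0` and the image of `F_0 → F_1` essential in `F_1`. -/
def IsMinSecondCosyzygy (N M : Type)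
    [AddCommGroup N] [Module (Amod k p) N] [AddCommGroup M] [Module (Amod k p) M] : Prop :=
  ∃ (r s : ℕ) (f : M →ₗ[Amod k p] (Fin r → Amod k p))
    (g : (Fin r → Amod k p) →ₗ[Amod k p] (Fin s → Amod k p))
    (h : (Fin s → Amod k p) →ₗ[Amod k p] N),
      Function.Injective f ∧
      LinearMap.ker g = LinearMap.range f ∧
      Function.Surjective h ∧
      LinearMap.ker h = LinearMap.range g ∧
      IsEssentialSub k p (LinearMap.range f) ∧
      IsEssentialSub k p (LinearMap.range g)

section LinAlg
variable {K : Type*} [Field K] {V W : Type*} [AddCommGroup V] [Module K V] [AddCommGroup W] [Module K W]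

/-- The linear-algebra data of a free module of rank `r`. -/
structure FL (p q r : ℕ) (X Y : V →ₗ[K] V) : Prop where
  comm : ∀ v, X (Y v) = Y (X v)
  xp : ∀ v, X ((X ^ (p - 1)) v) = 0
  yp : ∀ v, Y ((Y ^ (p - 1)) v) = 0
  kx : ∀ v, X v = 0 → ∃ w, v = (X ^ (p - 1)) w
  kx' : ∀ v, (X ^ (p - 1)) v = 0 → ∃ w, v = X w
  ks : ∀ v, (X ^ (p - 1)) ((Y ^ (p - 1)) v) = 0 → ∃ a b, v = X a + Y b
  kz : ∀ a b, X a + Y b = 0 → ∃ α β γ, a = Y β + (X ^ (p - 1)) α ∧ b = - X β + (Y ^ (p - 1)) γ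
  dk : finrank K (LinearMap.ker X) = q * r
  dm : finrank K (LinearMap.range X ⊔ LinearMap.range Y : Submodule K V) + r = finrank K V
  ds : finrank K (LinearMap.ker X ⊓ LinearMap.ker Y : Submodule K V) = r

theorem arith1 {p q s t σ : ℕ} (hp : 3 ≤ p) (hq : p ≤ q) (I1 : q * t ≤ q * s + t)
    (I2 : s + σ ≤ t) (c5 : s ≤ (p - 2) * σ) : s = 0 := by
  obtain ⟨τ, rfl⟩ := Nat.exists_eq_add_of_le (le_trans (Nat.le_add_right s σ) I2)
  obtain ⟨d, rfl⟩ := Nat.exists_eq_add_of_le (show 2 ≤ p by omega)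
  obtain ⟨e, rfl⟩ := Nat.exists_eq_add_of_le hq
  have h2 : σ ≤ τ := by omega
  have hd : 2 + d - 2 = d := by omega
  rw [hd] at c5
  have h3 : d * σ ≤ d * τ := Nat.mul_le_mul_left _ h2
  have : τ = 0 := by nlinarith [Nat.zero_le (e * τ)]
  have : σ = 0 := by omega
  rw [this] at c5; omega

/-- A product of submodules as a product of modules. -/
def subProdEquiv (U : Submodule K V) (U' : Submodule K W) : (U.prod U') ≃ₗ[K] U × U' where
  toFun v := (⟨v.1.1, v.2.1⟩, ⟨v.1.2, v.2.2⟩)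
  invFun v := ⟨(v.1.1, v.2.1), ⟨v.1.2, v.2.2⟩⟩
  map_add' _ _ := rfl
  map_smul' _ _ := rfl
  left_inv _ := rfl
  right_inv _ := rfl

theorem fn_map [FiniteDimensional K V] (g : V →ₗ[K] W) (U : Submodule K V) :
    finrank K (U.map g) + finrank K (LinearMap.ker g ⊓ U : Submodule K V) = finrank K U := by
  have h := LinearMap.finrank_range_add_finrank_ker (g.domRestrict U)
  rw [LinearMap.range_domRestrict] at h
  have e : finrank K (LinearMap.ker (g.domRestrict U)) =
      finrank K (LinearMap.ker g ⊓ U : Submodule K V) := by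
    rw [LinearMap.ker_domRestrict]
    have := LinearEquiv.finrank_eq (Submodule.equivMapOfInjective U.subtype U.injective_subtype
      ((LinearMap.ker g).comap U.subtype))
    change finrank K ((LinearMap.ker g).comap U.subtype) = _
    rw [this, Submodule.map_comap_subtype, inf_comm]
  omega

theorem fn_sup_ker [FiniteDimensional K V] (g : V →ₗ[K] W) (U : Submodule K V) :
    finrank K (LinearMap.ker g ⊔ U : Submodule K V) =
      finrank K (LinearMap.ker g) + finrank K (U.map g) := by
  have h1 := fn_map g U
  have h2 := Submodule.finrank_sup_add_finrank_inf_eq (LinearMap.ker g) U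
  omega

theorem fn_map_ge [FiniteDimensional K V] (g : V →ₗ[K] W) (U : Submodule K V) :
    finrank K (LinearMap.range g) + finrank K U ≤ finrank K (U.map g) + finrank K V := by
  have h1 := fn_map g U
  have h2 := LinearMap.finrank_range_add_finrank_ker g
  have h3 := Submodule.finrank_mono (inf_le_left : LinearMap.ker g ⊓ U ≤ LinearMap.ker g)
  omega

theorem fn_comap_le [FiniteDimensional K V] [FiniteDimensional K W] (g : V →ₗ[K] W)
    (U : Submodule K W) :
    finrank K (U.comap g) ≤ finrank K (LinearMap.ker g) + finrank K U := by
  have h1 := fn_map g (U.comap g)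
  have h3 := Submodule.finrank_mono (inf_le_left : LinearMap.ker g ⊓ U.comap g ≤ LinearMap.ker g)
  have h4 := Submodule.finrank_mono (Submodule.map_comap_le g U)
  omega

theorem pow_comm {X : V →ₗ[K] V} {X' : W →ₗ[K] W} (g : V →ₗ[K] W)
    (h : ∀ v, g (X v) = X' (g v)) (n : ℕ) (v : V) : g ((X ^ n) v) = (X' ^ n) (g v) := by
  induction n generalizing v with
  | zero => simp
  | succ n ih => rw [pow_succ, pow_succ, Module.End.mul_apply, Module.End.mul_apply, ih, h]

theorem fn_nilp [FiniteDimensional K V] (X Y : V →ₗ[K] V) (hc : ∀ v, X (Y v) = Y (X v)) (d : ℕ)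
    (hY : ∀ v, (Y ^ d) v = 0) :
    finrank K (LinearMap.ker X) ≤
      d * finrank K (LinearMap.ker X ⊓ LinearMap.ker Y : Submodule K V) := by
  have key : ∀ j : ℕ, finrank K (LinearMap.ker X ⊓ LinearMap.ker (Y ^ j) : Submodule K V) ≤
      j * finrank K (LinearMap.ker X ⊓ LinearMap.ker Y : Submodule K V) := by
    intro j
    induction j with
    | zero => 
      have : LinearMap.ker (Y ^ 0) = ⊥ := by
        ext v; simp
      rw [this]; simp
    | succ j ih =>
      have h1 := fn_map Y (LinearMap.ker X ⊓ LinearMap.ker (Y ^ (j+1)))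
      have h2 : (LinearMap.ker X ⊓ LinearMap.ker (Y ^ (j+1))).map Y ≤
          LinearMap.ker X ⊓ LinearMap.ker (Y ^ j) := by
        rintro _ ⟨v, ⟨hv1, hv2⟩, rfl⟩
        simp only [SetLike.mem_coe, LinearMap.mem_ker] at hv1 hv2
        refine ⟨?_, ?_⟩
        · simp [hc, hv1]
        · rw [pow_succ, Module.End.mul_apply] at hv2
          exact hv2
      have h3 : LinearMap.ker Y ⊓ (LinearMap.ker X ⊓ LinearMap.ker (Y ^ (j+1))) ≤
          LinearMap.ker X ⊓ LinearMap.ker Y := by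
        rintro v ⟨h, h', -⟩
        exact ⟨h', h⟩
      have h4 := Submodule.finrank_mono h2
      have h5 := Submodule.finrank_mono h3
      rw [add_mul, one_mul]
      omega
  have := key d
  have e : LinearMap.ker (Y ^ d) = ⊤ := by
    ext v; simp [hY]
  rwa [e, inf_top_eq] at this

theorem inj_nilp (X : V →ₗ[K] V) (d : ℕ) (hX : ∀ v, (X ^ d) v = 0)
    (hk : ∀ v, X v = 0 → v = 0) (v : V) : v = 0 := by
  have : ∀ j : ℕ, ∀ v, (X ^ j) v = 0 → v = 0 := by
    intro j
    induction j with
    | zero => intro v h; simpa using h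
    | succ j ih =>
      intro v h
      rw [pow_succ, Module.End.mul_apply] at h
      exact hk _ (ih _ h)
  exact this d v (hX v)

variable {M F0 F1 : Type*} [AddCommGroup M] [Module K M] [AddCommGroup F0] [Module K F0]
  [AddCommGroup F1] [Module K F1] [FiniteDimensional K M] [FiniteDimensional K F0]
  [FiniteDimensional K F1]

/-- dimension of `ker (a,b) ↦ X a + Y b` via coprod -/
theorem fn_coprod (X Y : V →ₗ[K] V) [FiniteDimensional K V] :
    finrank K (LinearMap.range X ⊔ LinearMap.range Y : Submodule K V) +
      finrank K (LinearMap.ker (X.coprod Y)) = 2 * finrank K V := by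
  have h := LinearMap.finrank_range_add_finrank_ker (X.coprod Y)
  rw [LinearMap.range_coprod, Module.finrank_prod] at h
  omega

theorem part1 {p q s t : ℕ} (hp : 3 ≤ p) (hq : p ≤ q)
    (X0 Y0 : F0 →ₗ[K] F0) (X1 Y1 : F1 →ₗ[K] F1) (XM YM : M →ₗ[K] M)
    (h0 : FL p q s X0 Y0) (h1 : FL p q t X1 Y1) (hcM : ∀ v, XM (YM v) = YM (XM v))
    (π : F0 →ₗ[K] M) (g : F1 →ₗ[K] F0)
    (πX : ∀ v, π (X0 v) = XM (π v)) (πY : ∀ v, π (Y0 v) = YM (π v))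
    (gX : ∀ v, g (X1 v) = X0 (g v)) (gY : ∀ v, g (Y1 v) = Y0 (g v))
    (hπ : Function.Surjective π) (hex : LinearMap.range g = LinearMap.ker π)
    (hmin : LinearMap.ker π ≤ LinearMap.range X0 ⊔ LinearMap.range Y0)
    (hE : ∀ m, ∃ m', YM m = XM m')
    (hXM : ∀ m, (XM ^ (p - 2)) m = 0) (hYM : ∀ m, (YM ^ (p - 2)) m = 0)
    (hN : ∀ n, g n = 0 → ∃ n', Y1 n = X1 n') : ∀ m : M, m = 0 := by
  have pp : p - 1 = (p - 2) + 1 := by omega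
  have hXM1 : ∀ m, (XM ^ (p - 1)) m = 0 := by
    intro m; rw [pp, pow_succ, Module.End.mul_apply]; exact hXM _
  have hYM1 : ∀ m, (YM ^ (p - 1)) m = 0 := by
    intro m; rw [pp, pow_succ, Module.End.mul_apply]; exact hYM _
  set N := LinearMap.ker g
  -- step 1
  have s1 : LinearMap.ker X0 ≤ LinearMap.ker π := by
    intro v hv
    obtain ⟨w, rfl⟩ := h0.kx v hv
    rw [LinearMap.mem_ker, pow_comm π πX, hXM1]
  have s2 := fn_map X0 (LinearMap.ker π)
  rw [inf_eq_left.mpr s1, h0.dk] at s2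
  have s3 := fn_sup_ker g (LinearMap.range X1)
  have e3 : (LinearMap.range X1).map g = (LinearMap.ker π).map X0 := by
    rw [← hex, ← LinearMap.range_comp, ← LinearMap.range_comp]
    congr 1; ext v; exact gX v
  rw [e3] at s3
  have rk1 := LinearMap.finrank_range_add_finrank_ker g
  rw [hex] at rk1
  -- step 4
  have s4 : LinearMap.ker g ⊔ LinearMap.range X1 ≤ (LinearMap.range X1).comap Y1 := by
    apply sup_le
    · intro n hn
      obtain ⟨n', h⟩ := hN n hn
      exact ⟨n', h.symm⟩
    · rintro _ ⟨v, rfl⟩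
      exact ⟨Y1 v, h1.comm v⟩
  have s4' := Submodule.finrank_mono s4
  have s5 : finrank K ((LinearMap.range X1).comap Y1) + q * t ≤ finrank K F1 + t := by
    have a1 := fn_coprod X1 Y1
    have a2 := h1.dm
    have a3 := fn_map (LinearMap.snd K F1 F1) (LinearMap.ker (X1.coprod Y1))
    have a4 : (LinearMap.range X1).comap Y1 ≤
        (LinearMap.ker (X1.coprod Y1)).map (LinearMap.snd K F1 F1) := by
      rintro v ⟨w, hw⟩
      refine ⟨(-w, v), ?_, rfl⟩
      simp [hw]
    have a5 : (LinearMap.ker X1).map (LinearMap.inl K F1 F1) ≤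
        (LinearMap.ker (LinearMap.snd K F1 F1) ⊓ LinearMap.ker (X1.coprod Y1)) := by
      rintro _ ⟨v, hv, rfl⟩
      simpa using hv
    have a6 := Submodule.finrank_mono a4
    have a7 := Submodule.finrank_mono a5
    have a8 := LinearEquiv.finrank_eq (Submodule.equivMapOfInjective (LinearMap.inl K F1 F1)
      LinearMap.inl_injective (LinearMap.ker X1))
    have a9 := h1.dk
    omega
  have rk2 := LinearMap.finrank_range_add_finrank_ker X1
  have dk1 := h1.dk
  have rk0 := LinearMap.finrank_range_add_finrank_ker X0
  have dm1 := h1.dm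
  have I1 : q * t ≤ q * s + t := by omega
  -- step 5
  have s6 := fn_map_ge g (LinearMap.range X1 ⊔ LinearMap.range Y1)
  have e6 : (LinearMap.range X1 ⊔ LinearMap.range Y1).map g =
      (LinearMap.ker π).map X0 ⊔ (LinearMap.ker π).map Y0 := by
    rw [Submodule.map_sup, e3]
    congr 1
    rw [← hex, ← LinearMap.range_comp, ← LinearMap.range_comp]
    congr 1; ext v; exact gY v
  rw [e6, hex] at s6
  -- step 6
  let KK := (LinearMap.ker π).prod (LinearMap.ker π)
  have b1 := fn_map (X0.coprod Y0) KK
  have e1 : KK.map (X0.coprod Y0) = (LinearMap.ker π).map X0 ⊔ (LinearMap.ker π).map Y0 := by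
    rw [← LinearMap.coprod_map_prod]
  have b2 : finrank K KK = 2 * finrank K (LinearMap.ker π) := by
    rw [LinearEquiv.finrank_eq (subProdEquiv (LinearMap.ker π) (LinearMap.ker π)),
      Module.finrank_prod]
    omega
  have b3 := fn_map (π.prodMap π) (LinearMap.ker (X0.coprod Y0))
  have b4 : (LinearMap.ker (X0.coprod Y0)).map (π.prodMap π) ≤ LinearMap.range (YM.prod (-XM)) := by
    rintro _ ⟨⟨a, b⟩, h, rfl⟩
    obtain ⟨α, β, γ, rfl, rfl⟩ := h0.kz a b (by simpa using h)
    refine ⟨π β, ?_⟩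
    simp [pow_comm π πX, pow_comm π πY, πX, πY, hXM1, hYM1]
  have b5 : LinearMap.ker (π.prodMap π) ⊓ LinearMap.ker (X0.coprod Y0) ≤
      LinearMap.ker (X0.coprod Y0) ⊓ KK := by
    rintro ⟨a, b⟩ ⟨h, h'⟩
    refine ⟨h', ?_⟩
    simpa [KK] using h
  have b6 := LinearMap.finrank_range_add_finrank_ker (YM.prod (-XM))
  have b7 : LinearMap.ker (YM.prod (-XM)) = LinearMap.ker XM ⊓ LinearMap.ker YM := by
    ext v; simp [and_comm]
  rw [b7] at b6
  have b8 := Submodule.finrank_mono b4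
  have b9 := Submodule.finrank_mono b5
  have b10 := fn_coprod X0 Y0
  have dm0 := h0.dm
  have rkπ := LinearMap.finrank_range_add_finrank_ker π
  rw [LinearMap.range_eq_top.mpr hπ, finrank_top] at rkπ
  rw [e1] at b1
  set σ := finrank K (LinearMap.ker XM ⊓ LinearMap.ker YM : Submodule K M)
  have I2 : s + σ ≤ t := by omega
  -- step 7
  have c1 := fn_map π (LinearMap.range X0 ⊔ LinearMap.range Y0)
  rw [inf_eq_left.mpr hmin] at c1
  have c2 : (LinearMap.range X0 ⊔ LinearMap.range Y0).map π = LinearMap.range XM := by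
    apply le_antisymm
    · rw [Submodule.map_sup]
      apply sup_le
      · rintro _ ⟨_, ⟨v, rfl⟩, rfl⟩
        exact ⟨π v, (πX v).symm⟩
      · rintro _ ⟨_, ⟨v, rfl⟩, rfl⟩
        rw [πY]
        obtain ⟨m', h⟩ := hE (π v)
        exact ⟨m', h.symm⟩
    · rintro _ ⟨m, rfl⟩
      obtain ⟨v, rfl⟩ := hπ m
      exact ⟨X0 v, Submodule.mem_sup_left ⟨v, rfl⟩, πX v⟩
  rw [c2] at c1
  have c3 := LinearMap.finrank_range_add_finrank_ker XM
  have c4 : finrank K (LinearMap.ker XM) = s := by omega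
  have c5 := fn_nilp XM YM hcM (p - 2) hYM
  rw [c4] at c5
  have hs : s = 0 := arith1 hp hq I1 I2 c5
  rw [hs] at c4
  have c6 : LinearMap.ker XM = ⊥ := Submodule.finrank_eq_zero.mp c4
  exact inj_nilp XM (p - 2) hXM (fun v hv => by
    have : v ∈ LinearMap.ker XM := hv
    rw [c6] at this; simpa using this)

theorem part2 {p q r t : ℕ} (hp : 3 ≤ p) (hq : p ≤ q)
    (X0 Y0 : F0 →ₗ[K] F0) (X1 Y1 : F1 →ₗ[K] F1) (XM YM : M →ₗ[K] M)
    (h0 : FL p q r X0 Y0) (h1 : FL p q t X1 Y1)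
    (f : M →ₗ[K] F0) (g : F0 →ₗ[K] F1)
    (fX : ∀ v, f (XM v) = X0 (f v)) (fY : ∀ v, f (YM v) = Y0 (f v))
    (gX : ∀ v, g (X0 v) = X1 (g v)) (gY : ∀ v, g (Y0 v) = Y1 (g v))
    (hf : Function.Injective f) (hex : LinearMap.ker g = LinearMap.range f)
    (hmin : LinearMap.ker X0 ⊓ LinearMap.ker Y0 ≤ LinearMap.range f)
    (hE : ∀ m, ∃ m', YM m = XM m')
    (hXM : ∀ m, (XM ^ (p - 2)) m = 0) (hYM : ∀ m, (YM ^ (p - 2)) m = 0)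
    (hN : ∀ v, ∃ w l, Y1 v = X1 w + g l) : ∀ m : M, m = 0 := by
  have pp : p - 1 = (p - 2) + 1 := by omega
  have hXM1 : ∀ m, (XM ^ (p - 1)) m = 0 := by
    intro m; rw [pp, pow_succ, Module.End.mul_apply]; exact hXM _
  have hYM1 : ∀ m, (YM ^ (p - 1)) m = 0 := by
    intro m; rw [pp, pow_succ, Module.End.mul_apply]; exact hYM _
  have xp' : ∀ v, (X1 ^ (p - 1)) (X1 v) = 0 := by
    intro v
    rw [← Module.End.mul_apply, ← pow_succ, pow_succ', Module.End.mul_apply, h1.xp]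
  have kerxp : LinearMap.ker (X1 ^ (p - 1)) = LinearMap.range X1 := by
    apply le_antisymm
    · intro v hv
      obtain ⟨w, rfl⟩ := h1.kx' v hv
      exact ⟨w, rfl⟩
    · rintro _ ⟨w, rfl⟩
      exact xp' w
  have kerx0 : LinearMap.ker X0 = LinearMap.range (X0 ^ (p - 1)) := by
    apply le_antisymm
    · intro v hv
      obtain ⟨w, rfl⟩ := h0.kx v hv
      exact ⟨w, rfl⟩
    · rintro _ ⟨w, rfl⟩
      exact h0.xp w
  set s := finrank K (LinearMap.ker XM) with hs
  have mapker : (LinearMap.ker XM).map f = LinearMap.range f ⊓ LinearMap.ker X0 := by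
    ext v
    constructor
    · rintro ⟨m, hm, rfl⟩
      refine ⟨⟨m, rfl⟩, ?_⟩
      have hm' : XM m = 0 := hm
      change X0 (f m) = 0
      rw [← fX, hm', map_zero]
    · rintro ⟨⟨m, rfl⟩, hv⟩
      refine ⟨m, ?_, rfl⟩
      have hv' : X0 (f m) = 0 := hv
      rw [← fX] at hv'
      exact hf (by rw [hv', map_zero])
  have fs : finrank K (LinearMap.range f ⊓ LinearMap.ker X0 : Submodule K F0) = s := by
    rw [← mapker]
    exact (LinearEquiv.finrank_eq (Submodule.equivMapOfInjective f hf _)).symm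
  -- step 1
  have I1 : r ≤ s := by
    rw [← fs, ← h0.ds]
    exact Submodule.finrank_mono (le_inf hmin inf_le_left)
  -- step 2
  have d1 := fn_sup_ker (X1 ^ (p - 1)) (LinearMap.range g)
  rw [kerxp] at d1
  have d2 : (LinearMap.range g).map (X1 ^ (p - 1)) = (LinearMap.ker X0).map g := by
    rw [kerx0, ← LinearMap.range_comp, ← LinearMap.range_comp]
    congr 1; ext v; exact (pow_comm g gX _ v).symm
  have d3 := fn_map g (LinearMap.ker X0)
  rw [hex, fs, h0.dk] at d3
  rw [d2] at d1
  have d4 : LinearMap.range X1 ⊔ LinearMap.range Y1 ≤ LinearMap.range X1 ⊔ LinearMap.range g := by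
    apply sup_le le_sup_left
    rintro _ ⟨v, rfl⟩
    obtain ⟨w, l, h⟩ := hN v
    rw [h]
    exact Submodule.add_mem_sup ⟨w, rfl⟩ ⟨l, rfl⟩
  have d5 := Submodule.finrank_mono d4
  have d6 := h1.dm
  have d7 := LinearMap.finrank_range_add_finrank_ker X1
  have d8 := h1.dk
  have I2 : q * t + s ≤ q * r + t := by omega
  -- step 3
  let Q := (LinearMap.range f).comap X0 ⊓ (LinearMap.range f).comap Y0
  have fQ : LinearMap.ker g ≤ Q := by
    rw [hex]
    rintro _ ⟨m, rfl⟩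
    exact ⟨⟨XM m, fX m⟩, ⟨YM m, fY m⟩⟩
  have e1 := fn_map g Q
  rw [inf_eq_left.mpr fQ, hex, LinearMap.finrank_range_of_inj hf] at e1
  have e2 : Q.map g ≤ LinearMap.ker X1 ⊓ LinearMap.ker Y1 := by
    rintro _ ⟨v, ⟨h, h'⟩, rfl⟩
    have h2 : X0 v ∈ LinearMap.range f := h
    have h2' : Y0 v ∈ LinearMap.range f := h'
    rw [← hex] at h2 h2'
    refine ⟨?_, ?_⟩
    · change X1 (g v) = 0
      rw [← gX]; exact h2
    · change Y1 (g v) = 0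
      rw [← gY]; exact h2'
  have e3 := Submodule.finrank_mono e2
  rw [h1.ds] at e3
  let Z := (LinearMap.ker (YM.coprod (-XM)))
  have hZ : finrank K Z = finrank K M + s := by
    have a1 := fn_coprod YM (-XM)
    have a2 : LinearMap.range YM ⊔ LinearMap.range (-XM) = LinearMap.range XM := by
      rw [LinearMap.range_neg]
      apply sup_eq_right.mpr
      rintro _ ⟨m, rfl⟩
      obtain ⟨m', h⟩ := hE m
      exact ⟨m', h.symm⟩
    rw [a2] at a1
    have := LinearMap.finrank_range_add_finrank_ker XM
    change finrank K (LinearMap.ker (YM.coprod (-XM))) = _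
    omega
  have hZ' : finrank K (Z.map (f.prodMap f)) = finrank K Z :=
    (LinearEquiv.finrank_eq (Submodule.equivMapOfInjective (f.prodMap f)
      (by intro a b h; simp at h; exact Prod.ext (hf h.1) (hf h.2)) _)).symm
  have e4 : Z.map (f.prodMap f) ≤ Q.map (X0.prod Y0) := by
    rintro _ ⟨⟨m1, m2⟩, hm, rfl⟩
    have hm' : YM m1 = XM m2 := by
      have : YM m1 + (- XM m2) = 0 := by simpa [Z] using hm
      exact add_neg_eq_zero.mp this
    obtain ⟨a, ha⟩ := h0.kx' (f m1) (by rw [← pow_comm f fX, hXM1, map_zero])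
    have h2 : X0 (Y0 a - f m2) = 0 := by
      rw [map_sub, h0.comm, ← ha, ← fX, ← fY, hm', sub_self]
    obtain ⟨c, hc⟩ := h0.kx _ h2
    have h3 : (X0 ^ (p - 1)) ((Y0 ^ (p - 1)) c) = 0 := by
      have := pow_comm (X' := Y0) (X := Y0) (X0 ^ (p-1))
        (fun v => (pow_comm (X := X0) (X' := X0) Y0 (fun v => (h0.comm v).symm) (p-1) v).symm) (p-1) c
      rw [this, ← hc, map_sub, ← pow_comm f fY, hYM1, map_zero, sub_zero,
        ← Module.End.mul_apply, ← pow_succ, pow_succ', Module.End.mul_apply, h0.yp]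
    obtain ⟨c1, c2, rfl⟩ := h0.ks c h3
    have h4 : (X0 ^ (p - 1)) (X0 c1 + Y0 c2) = Y0 ((X0 ^ (p - 1)) c2) := by
      rw [map_add, ← Module.End.mul_apply, ← pow_succ, pow_succ', Module.End.mul_apply, h0.xp,
        zero_add]
      exact (pow_comm (X := X0) (X' := X0) Y0 (fun v => (h0.comm v).symm) (p-1) c2).symm
    rw [h4] at hc
    have r1 : X0 (a - (X0 ^ (p - 1)) c2) = f m1 := by
      rw [map_sub, h0.xp, sub_zero, ha]
    have r2 : Y0 (a - (X0 ^ (p - 1)) c2) = f m2 := by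
      rw [map_sub, ← hc]; abel
    refine ⟨a - (X0 ^ (p - 1)) c2, ⟨⟨m1, r1.symm⟩, ⟨m2, r2.symm⟩⟩, ?_⟩
    exact Prod.ext r1 r2
  have e5 := Submodule.finrank_mono e4
  have e6 := fn_map (X0.prod Y0) Q
  have e7 : LinearMap.ker X0 ⊓ LinearMap.ker Y0 ≤ LinearMap.ker (X0.prod Y0) ⊓ Q := by
    rintro v ⟨h, h'⟩
    have k1 : X0 v = 0 := h
    have k2 : Y0 v = 0 := h'
    refine ⟨by simp [k1, k2], ?_, ?_⟩
    · simp [k1]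
    · simp [k2]
  have e8 := Submodule.finrank_mono e7
  rw [h0.ds] at e8
  have I3 : r + s ≤ t := by omega
  have s0 : s = 0 := by
    obtain ⟨τ, rfl⟩ := Nat.exists_eq_add_of_le I3
    obtain ⟨e, rfl⟩ := Nat.exists_eq_add_of_le (show 3 ≤ q by omega)
    nlinarith [Nat.zero_le (e * s), Nat.zero_le (e * τ)]
  have c6 : LinearMap.ker XM = ⊥ := Submodule.finrank_eq_zero.mp (hs ▸ s0)
  exact inj_nilp XM (p - 2) hXM (fun v hv => by
    have : v ∈ LinearMap.ker XM := hv
    rw [c6] at this; simpa using this)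

end LinAlg

section Alg

theorem mem_span2 (a b : ℕ) (f : MvPolynomial (Fin 2) k) :
    f ∈ Ideal.span {(X 0 : MvPolynomial (Fin 2) k) ^ a, (X 1 : MvPolynomial (Fin 2) k) ^ b} ↔
      ∀ m ∈ f.support, a ≤ m 0 ∨ b ≤ m 1 := by
  have h := @mem_ideal_span_monomial_image (Fin 2) k _ f
    {Finsupp.single 0 a, Finsupp.single 1 b}
  rw [Set.image_pair] at h
  rw [X_pow_eq_monomial, X_pow_eq_monomial, h]
  simp [Finsupp.single_le_iff]

theorem xA_pow : xA k p ^ p = 0 := by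
  rw [xA, ← map_pow, Ideal.Quotient.eq_zero_iff_mem]
  exact Ideal.subset_span (by simp)

theorem yA_pow : yA k p ^ p = 0 := by
  rw [yA, ← map_pow, Ideal.Quotient.eq_zero_iff_mem]
  exact Ideal.subset_span (by simp)

theorem annA (a b : ℕ) (z : Amod k p) (h : xA k p ^ a * yA k p ^ b * z = 0) :
    ∃ c d, z = xA k p ^ (p - a) * c + yA k p ^ (p - b) * d := by
  obtain ⟨f, rfl⟩ := Ideal.Quotient.mk_surjective z
  rw [xA, yA, ← map_pow, ← map_pow, ← map_mul, ← map_mul, Ideal.Quotient.eq_zero_iff_mem, relI,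
    mem_span2, X_pow_eq_monomial, X_pow_eq_monomial, monomial_mul, one_mul] at h
  have h2 : f ∈ Ideal.span {(X 0 : MvPolynomial (Fin 2) k) ^ (p - a),
      (X 1 : MvPolynomial (Fin 2) k) ^ (p - b)} := by
    rw [mem_span2]
    intro m hm
    have := h ((Finsupp.single 0 a + Finsupp.single 1 b) + m) (by
      rw [MvPolynomial.mem_support_iff, coeff_monomial_mul, one_mul]
      exact MvPolynomial.mem_support_iff.mp hm)
    simp at this
    omega
  obtain ⟨c, d, hcd⟩ := Ideal.mem_span_pair.mp h2
  refine ⟨Ideal.Quotient.mk _ c, Ideal.Quotient.mk _ d, ?_⟩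
  rw [← hcd, xA, yA, map_add, map_mul, map_mul, map_pow, map_pow]
  ring

theorem finA [hp : Fact p.Prime] : FiniteDimensional k (Amod k p) := by
  have p0 : 0 < p := hp.out.pos
  have hx : IsIntegral k (xA k p) := IsIntegral.of_pow p0 (by rw [xA_pow]; exact isIntegral_zero)
  have hy : IsIntegral k (yA k p) := IsIntegral.of_pow p0 (by rw [yA_pow]; exact isIntegral_zero)
  have hint : Algebra.IsIntegral k (Amod k p) := by
    refine ⟨fun z => ?_⟩
    obtain ⟨f, rfl⟩ := Ideal.Quotient.mk_surjective z
    induction f using MvPolynomial.induction_on with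
    | C c => exact isIntegral_algebraMap (R := k) (x := c)
    | add f g hf hg => rw [map_add]; exact hf.add hg
    | mul_X f i hf =>
      rw [map_mul]
      refine hf.mul ?_
      fin_cases i
      · exact hx
      · exact hy
  have hft : Algebra.FiniteType k (Amod k p) :=
    Algebra.FiniteType.of_surjective (Ideal.Quotient.mkₐ k (relI k p))
      (Ideal.Quotient.mkₐ_surjective k (relI k p))
  exact Algebra.IsIntegral.finite

variable {k p}

/-- Multiplication by `a` as a `k`-linear map. -/
def opr (M : Type) [AddCommGroup M] [Module (Amod k p) M] [Module k M]
    [IsScalarTower k (Amod k p) M] (a : Amod k p) : M →ₗ[k] M :=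
  (LinearMap.lsmul (Amod k p) M a).restrictScalars k

section
variable {M : Type} [AddCommGroup M] [Module (Amod k p) M] [Module k M]
    [IsScalarTower k (Amod k p) M]

theorem opr_apply (a : Amod k p) (m : M) : opr M a m = a • m := rfl

theorem opr_pow (a : Amod k p) (n : ℕ) (m : M) : (opr M a ^ n) m = a ^ n • m := by
  induction n generalizing m with
  | zero => simp
  | succ n ih => rw [pow_succ, Module.End.mul_apply, ih, opr_apply, pow_succ, mul_smul]
end

theorem const_decomp (z : Amod k p) : ∃ (c : k) (a b : Amod k p),
    z = algebraMap k (Amod k p) c + xA k p * a + yA k p * b := by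
  obtain ⟨f, rfl⟩ := Ideal.Quotient.mk_surjective z
  induction f using MvPolynomial.induction_on with
  | C c => exact ⟨c, 0, 0, by simp; rfl⟩
  | add f g hf hg =>
    obtain ⟨c, a, b, h⟩ := hf
    obtain ⟨c', a', b', h'⟩ := hg
    refine ⟨c + c', a + a', b + b', ?_⟩
    rw [map_add, h, h', map_add]; ring
  | mul_X f i hf =>
    rw [map_mul]
    fin_cases i
    · exact ⟨0, Ideal.Quotient.mk _ f, 0, by
        rw [map_zero, mul_zero, add_zero, zero_add, mul_comm]; rfl⟩
    · exact ⟨0, 0, Ideal.Quotient.mk _ f, by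
        rw [map_zero, mul_zero, add_zero, zero_add, mul_comm]; rfl⟩

theorem const_notin [hp : Fact p.Prime] (c : k) (a b : Amod k p)
    (h : algebraMap k (Amod k p) c = xA k p * a + yA k p * b) : c = 0 := by
  obtain ⟨f, rfl⟩ := Ideal.Quotient.mk_surjective a
  obtain ⟨g, rfl⟩ := Ideal.Quotient.mk_surjective b
  have h2 : Ideal.Quotient.mk (relI k p) (C c - (X 0 * f + X 1 * g)) = 0 := by
    rw [map_sub, map_add, map_mul, map_mul, sub_eq_zero]; exact h
  rw [Ideal.Quotient.eq_zero_iff_mem, relI, mem_span2] at h2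
  by_contra hc
  have := h2 0 (by
    rw [MvPolynomial.mem_support_iff]
    have : coeff 0 (C c - (X 0 * f + X 1 * g)) = c := by
      simp [← constantCoeff_eq]
    rwa [this])
  have := hp.out.pos
  simp at *
  omega

theorem q_ge [hp : Fact p.Prime] :
    p ≤ finrank k (LinearMap.ker (opr (Amod k p) (xA k p))) := by
  have := finA k p
  have p0 : 0 < p := hp.out.pos
  let φ : Fin p → Amod k p := fun j => xA k p ^ (p - 1) * yA k p ^ (j : ℕ)
  have hli : LinearIndependent k φ := by
    rw [Fintype.linearIndependent_iff]
    intro c hc j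
    have h2 : Ideal.Quotient.mk (relI k p)
        (∑ i : Fin p, monomial (Finsupp.single 0 (p - 1) + Finsupp.single 1 (i : ℕ)) (c i)) = 0 := by
      rw [← hc, map_sum]
      refine Finset.sum_congr rfl fun i _ => ?_
      have : monomial (Finsupp.single 0 (p - 1) + Finsupp.single 1 (i : ℕ)) (c i) =
          c i • ((X 0 : MvPolynomial (Fin 2) k) ^ (p - 1) * X 1 ^ (i : ℕ)) := by
        rw [X_pow_eq_monomial, X_pow_eq_monomial, monomial_mul, smul_monomial]
        simp
      rw [this]
      rfl
    rw [Ideal.Quotient.eq_zero_iff_mem, relI, mem_span2] at h2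
    by_contra hcj
    have := h2 (Finsupp.single 0 (p - 1) + Finsupp.single 1 (j : ℕ)) (by
      rw [MvPolynomial.mem_support_iff, coeff_sum, Finset.sum_eq_single j]
      · simpa using hcj
      · intro i _ hij
        rw [coeff_monomial, if_neg]
        intro h
        have := DFunLike.congr_fun h 1
        simp at this
        exact hij (Fin.ext this)
      · simp)
    simp at this
    have := j.2
    omega
  have hmem : ∀ j, φ j ∈ LinearMap.ker (opr (Amod k p) (xA k p)) := by
    intro j
    rw [LinearMap.mem_ker, opr_apply, smul_eq_mul]
    change xA k p * (xA k p ^ (p - 1) * _) = 0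
    rw [← mul_assoc, ← pow_succ', Nat.sub_add_cancel p0, xA_pow, zero_mul]
  have hli2 : LinearIndependent k
      (fun j => (⟨φ j, hmem j⟩ : LinearMap.ker (opr (Amod k p) (xA k p)))) :=
    LinearIndependent.of_comp (LinearMap.ker (opr (Amod k p) (xA k p))).subtype hli
  simpa using hli2.fintype_card_le_finrank

theorem finrank_piU {r : ℕ} (U : Submodule k (Amod k p)) (U' : Submodule k (Fin r → Amod k p))
    [FiniteDimensional k (Amod k p)]
    (h : ∀ v, v ∈ U' ↔ ∀ i, v i ∈ U) : finrank k U' = finrank k U * r := by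
  let e : U' ≃ₗ[k] (Fin r → U) :=
    { toFun := fun v i => ⟨v.1 i, (h v.1).mp v.2 i⟩
      invFun := fun v => ⟨fun i => (v i).1, (h _).mpr fun i => (v i).2⟩
      map_add' := fun _ _ => rfl
      map_smul' := fun _ _ => rfl
      left_inv := fun _ => rfl
      right_inv := fun _ => rfl }
  rw [e.finrank_eq, Module.finrank_pi_fintype]
  simp [mul_comm]

theorem mem_rr {M : Type} [AddCommGroup M] [Module (Amod k p) M] [Module k M]
    [IsScalarTower k (Amod k p) M] (v : M) :
    v ∈ LinearMap.range (opr M (xA k p)) ⊔ LinearMap.range (opr M (yA k p)) ↔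
      ∃ a b : M, v = xA k p • a + yA k p • b := by
  rw [Submodule.mem_sup]
  constructor
  · rintro ⟨_, ⟨a, rfl⟩, _, ⟨b, rfl⟩, rfl⟩
    exact ⟨a, b, rfl⟩
  · rintro ⟨a, b, rfl⟩
    exact ⟨_, ⟨a, rfl⟩, _, ⟨b, rfl⟩, rfl⟩

theorem kxA [hp : Fact p.Prime] (v : Amod k p) (h : xA k p * v = 0) :
    ∃ w, v = xA k p ^ (p - 1) * w := by
  obtain ⟨c, d, h⟩ := annA k p 1 0 v (by simpa using h)
  exact ⟨c, by rw [h, Nat.sub_zero, yA_pow, zero_mul, add_zero]⟩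

theorem kxA' [hp : Fact p.Prime] (v : Amod k p) (h : xA k p ^ (p - 1) * v = 0) :
    ∃ w, v = xA k p * w := by
  have p0 : 0 < p := hp.out.pos
  obtain ⟨c, d, h⟩ := annA k p (p - 1) 0 v (by simpa using h)
  rw [Nat.sub_zero, yA_pow, zero_mul, add_zero, Nat.sub_sub_self p0, pow_one] at h
  exact ⟨c, h⟩

theorem ksA [hp : Fact p.Prime] (v : Amod k p)
    (h : xA k p ^ (p - 1) * (yA k p ^ (p - 1) * v) = 0) :
    ∃ a b, v = xA k p * a + yA k p * b := by
  have p0 : 0 < p := hp.out.pos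
  obtain ⟨c, d, h⟩ := annA k p (p - 1) (p - 1) v (by rw [mul_assoc]; exact h)
  rw [Nat.sub_sub_self p0, pow_one, pow_one] at h
  exact ⟨c, d, h⟩

theorem kzA [hp : Fact p.Prime] (a b : Amod k p) (h : xA k p * a + yA k p * b = 0) :
    ∃ α β γ, a = yA k p * β + xA k p ^ (p - 1) * α ∧
      b = - (xA k p * β) + yA k p ^ (p - 1) * γ := by
  have p0 : 0 < p := hp.out.pos
  have hxp : xA k p ^ (p - 1) * xA k p = 0 := by
    rw [← pow_succ, Nat.sub_add_cancel p0, xA_pow]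
  have hyp : yA k p * yA k p ^ (p - 1) = 0 := by
    rw [← pow_succ', Nat.sub_add_cancel p0, yA_pow]
  obtain ⟨c, d, hb⟩ := annA k p (p - 1) 1 b (by
    linear_combination xA k p ^ (p - 1) * h - a * hxp)
  rw [Nat.sub_sub_self p0, pow_one] at hb
  obtain ⟨α, hα⟩ := kxA (a + yA k p * c) (by
    rw [hb] at h
    linear_combination h - d * hyp)
  refine ⟨α, -c, d, ?_, ?_⟩
  · linear_combination hα
  · linear_combination hb

theorem FL_A [hp : Fact p.Prime] :
    finrank k (LinearMap.range (opr (Amod k p) (xA k p)) ⊔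
      LinearMap.range (opr (Amod k p) (yA k p)) : Submodule k (Amod k p)) + 1
        = finrank k (Amod k p) ∧
    finrank k (LinearMap.ker (opr (Amod k p) (xA k p)) ⊓
      LinearMap.ker (opr (Amod k p) (yA k p)) : Submodule k (Amod k p)) = 1 := by
  have := finA k p
  have p0 : 0 < p := hp.out.pos
  have hxp : xA k p * xA k p ^ (p - 1) = 0 := by
    rw [← pow_succ', Nat.sub_add_cancel p0, xA_pow]
  have hyp : yA k p * yA k p ^ (p - 1) = 0 := by
    rw [← pow_succ', Nat.sub_add_cancel p0, yA_pow]
  let mm := (LinearMap.range (opr (Amod k p) (xA k p)) ⊔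
      LinearMap.range (opr (Amod k p) (yA k p)) : Submodule k (Amod k p))
  have h1 : finrank k mm + 1 = finrank k (Amod k p) := by
    have hc : IsCompl mm (LinearMap.range (Algebra.linearMap k (Amod k p))) := by
      refine IsCompl.of_eq ?_ ?_
      · rw [eq_bot_iff]
        rintro _ ⟨h, ⟨c, rfl⟩⟩
        obtain ⟨a, b, h⟩ := (mem_rr _).mp h
        have := const_notin c a b h
        simp [this]
      · rw [eq_top_iff]
        rintro z -
        obtain ⟨c, a, b, rfl⟩ := const_decomp z
        rw [add_assoc, add_comm]
        exact Submodule.add_mem_sup ((mem_rr _).mpr ⟨a, b, rfl⟩) ⟨c, rfl⟩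
    have := Submodule.finrank_add_eq_of_isCompl hc
    rw [LinearMap.finrank_range_of_inj, Module.finrank_self] at this
    · exact this
    · rw [← LinearMap.ker_eq_bot, eq_bot_iff]
      intro c hcc
      exact const_notin c 0 0 (by simpa using hcc)
  refine ⟨h1, ?_⟩
  let w := xA k p ^ (p - 1) * yA k p ^ (p - 1)
  have h2 := LinearMap.finrank_range_add_finrank_ker (opr (Amod k p) w)
  have h3 : LinearMap.ker (opr (Amod k p) w) = mm := by
    ext z
    rw [mem_rr, LinearMap.mem_ker, opr_apply, smul_eq_mul]
    constructor
    · intro h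
      exact ksA z (by rw [← mul_assoc]; exact h)
    · rintro ⟨a, b, rfl⟩
      simp only [smul_eq_mul, w]
      linear_combination (yA k p ^ (p - 1) * a) * hxp + (xA k p ^ (p - 1) * b) * hyp
  have h4 : LinearMap.range (opr (Amod k p) w) = (LinearMap.ker (opr (Amod k p) (xA k p)) ⊓
      LinearMap.ker (opr (Amod k p) (yA k p)) : Submodule k (Amod k p)) := by
    ext z
    rw [Submodule.mem_inf, LinearMap.mem_ker, LinearMap.mem_ker]
    simp only [opr_apply, smul_eq_mul]
    constructor
    · rintro ⟨a, rfl⟩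
      simp only [opr_apply, smul_eq_mul, w]
      constructor
      · linear_combination (yA k p ^ (p - 1) * a) * hxp
      · linear_combination (xA k p ^ (p - 1) * a) * hyp
    · rintro ⟨hx, hy⟩
      obtain ⟨b, rfl⟩ := kxA z hx
      obtain ⟨c, d, rfl⟩ := annA k p (p - 1) 1 b (by rw [← hy]; ring)
      refine ⟨d, ?_⟩
      rw [Nat.sub_sub_self p0, pow_one]
      simp only [opr_apply, smul_eq_mul, w]
      linear_combination (-c) * hxp
  rw [h3, h4] at h2
  omega

theorem FL_pi [hp : Fact p.Prime] (r : ℕ) :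
    FL p (finrank k (LinearMap.ker (opr (Amod k p) (xA k p)))) r
      (opr (Fin r → Amod k p) (xA k p)) (opr (Fin r → Amod k p) (yA k p)) := by
  have := finA k p
  have p0 : 0 < p := hp.out.pos
  obtain ⟨d1, d2⟩ := FL_A (k := k) (p := p)
  refine ⟨?_, ?_, ?_, ?_, ?_, ?_, ?_, ?_, ?_, ?_⟩
  · intro v; exact smul_comm (xA k p) (yA k p) v
  · intro v
    rw [opr_pow, opr_apply, smul_smul, ← pow_succ', Nat.sub_add_cancel p0, xA_pow]
    exact zero_smul (Amod k p) v
  · intro v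
    rw [opr_pow, opr_apply, smul_smul, ← pow_succ', Nat.sub_add_cancel p0, yA_pow]
    exact zero_smul (Amod k p) v
  · intro v hv
    have : ∀ i, ∃ w, v i = xA k p ^ (p - 1) * w := fun i => kxA _ (congrFun hv i)
    choose w hw using this
    exact ⟨w, by rw [opr_pow]; exact funext hw⟩
  · intro v hv
    rw [opr_pow] at hv
    have : ∀ i, ∃ w, v i = xA k p * w := fun i => kxA' _ (congrFun hv i)
    choose w hw using this
    exact ⟨w, funext hw⟩
  · intro v hv
    rw [opr_pow, opr_pow] at hv
    have : ∀ i, ∃ a b, v i = xA k p * a + yA k p * b := fun i => ksA _ (congrFun hv i)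
    choose a b hw using this
    exact ⟨a, b, funext hw⟩
  · intro a b h
    have : ∀ i, ∃ α β γ, a i = yA k p * β + xA k p ^ (p - 1) * α ∧
      b i = - (xA k p * β) + yA k p ^ (p - 1) * γ := fun i => kzA _ _ (congrFun h i)
    choose α β γ h1 h2 using this
    refine ⟨α, β, γ, ?_, ?_⟩
    · rw [opr_pow]; exact funext h1
    · rw [opr_pow]; exact funext h2
  · apply finrank_piU
    intro v
    simp only [LinearMap.mem_ker]
    exact _root_.funext_iff
  · rw [finrank_piU _ _ (fun v => ?_), Module.finrank_pi_fintype]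
    rotate_left
    · exact (LinearMap.range (opr (Amod k p) (xA k p)) ⊔
        LinearMap.range (opr (Amod k p) (yA k p)) : Submodule k (Amod k p))
    · rw [mem_rr]
      simp only [mem_rr]
      constructor
      · rintro ⟨a, b, rfl⟩ i
        exact ⟨a i, b i, rfl⟩
      · intro h
        choose a b h using h
        exact ⟨a, b, funext h⟩
    · rw [← d1]; simp; ring
  · rw [finrank_piU (LinearMap.ker (opr (Amod k p) (xA k p)) ⊓
      LinearMap.ker (opr (Amod k p) (yA k p))) _ (fun v => ?_), d2, one_mul]
    simp only [Submodule.mem_inf, LinearMap.mem_ker]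
    exact (and_congr _root_.funext_iff _root_.funext_iff).trans forall_and.symm

theorem xA_pt : IsPointOp k p (xA k p) := ⟨1, 0, by simp, by simp⟩

theorem EIP_use {M : Type} [AddCommGroup M] [Module (Amod k p) M] (h : EIP k p M) (m : M) :
    ∃ m', yA k p • m = xA k p • m' := by
  have h1 : yA k p • m ∈ mA k p • (⊤ : Submodule (Amod k p) M) :=
    Submodule.smul_mem_smul (Ideal.subset_span (by simp)) trivial
  rw [← h _ xA_pt] at h1
  obtain ⟨m', h⟩ := h1
  exact ⟨m', h.symm⟩

theorem pow_kill {M : Type} [AddCommGroup M] [Module (Amod k p) M] {d : ℕ}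
    (h : (mA k p) ^ d • (⊤ : Submodule (Amod k p) M) = ⊥) {a : Amod k p} (ha : a ∈ mA k p)
    (m : M) : a ^ d • m = 0 := by
  have : a ^ d • m ∈ (mA k p) ^ d • (⊤ : Submodule (Amod k p) M) :=
    Submodule.smul_mem_smul (Ideal.pow_mem_pow ha d) trivial
  rw [h] at this
  simpa using this

theorem mem_mA_smul {M : Type} [AddCommGroup M] [Module (Amod k p) M] (v : M)
    (h : v ∈ mA k p • (⊤ : Submodule (Amod k p) M)) :
    ∃ a b : M, v = xA k p • a + yA k p • b := by
  refine Submodule.smul_induction_on h ?_ ?_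
  · intro r hr n _
    obtain ⟨a, b, rfl⟩ := Ideal.mem_span_pair.mp hr
    refine ⟨a • n, b • n, ?_⟩
    rw [add_smul, mul_comm a, mul_comm b, mul_smul, mul_smul]
  · rintro _ _ ⟨a, b, rfl⟩ ⟨a', b', rfl⟩
    refine ⟨a + a', b + b', ?_⟩
    rw [smul_add, smul_add]; abel

theorem xA_mem : xA k p ∈ mA k p := Ideal.subset_span (by simp)
theorem yA_mem : yA k p ∈ mA k p := Ideal.subset_span (by simp)

end Alg

/-- for `p ≥ 3` and `M ≠ 0` in `EIP_{p−2}`, no minimal second syzygy of `M`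
has the equal images property, and no minimal second cosyzygy of `M` has the equal images
property. -/
theorem minSecondSyz_and_Cosyz_not_EIP_of_EIPd
    [IsAlgClosed k] [Fact p.Prime] [CharP k p] (hp3 : 3 ≤ p)
    (M : Type) [AddCommGroup M] [Module (Amod k p) M]
    [Module k M] [IsScalarTower k (Amod k p) M] [FiniteDimensional k M]
    (hM : Nontrivial M) (hE : EIPd k p (p - 2) M) :
    (∀ (N : Type) [AddCommGroup N] [Module (Amod k p) N],
      IsMinSyz k p 2 (ModuleCat.of (Amod k p) N) (ModuleCat.of (Amod k p) M) →
      ¬ EIP k p N) ∧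
    (∀ (N : Type) [AddCommGroup N] [Module (Amod k p) N],
      IsMinSecondCosyzygy k p N M → ¬ EIP k p N) := by
  have := finA k p
  obtain ⟨hE1, hE2⟩ := hE
  have hXM : ∀ m : M, (opr M (xA k p) ^ (p - 2)) m = 0 := fun m => by
    rw [opr_pow]; exact pow_kill hE2 xA_mem m
  have hYM : ∀ m : M, (opr M (yA k p) ^ (p - 2)) m = 0 := fun m => by
    rw [opr_pow]; exact pow_kill hE2 yA_mem m
  have key : ¬ ∀ m : M, m = 0 := by
    intro h
    obtain ⟨a, b, hab⟩ := hM
    exact hab ((h a).trans (h b).symm)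
  constructor
  · intro N _ _ hS hN
    obtain ⟨s, π, hπ, hmin, t, g, hg, -, ⟨e⟩⟩ := hS
    apply key
    change (Fin s → Amod k p) →ₗ[Amod k p] M at π
    change (Fin t → Amod k p) →ₗ[Amod k p] (LinearMap.ker π) at g
    change N ≃ₗ[Amod k p] (LinearMap.ker g) at e
    refine part1 (K := k) hp3 q_ge _ _ _ _ (opr M (xA k p)) (opr M (yA k p))
      (FL_pi s) (FL_pi t) (fun v => smul_comm (xA k p) (yA k p) v) (π.restrictScalars k)
      (((LinearMap.ker π).subtype.comp g).restrictScalars k)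
      (fun v => π.map_smul _ v) (fun v => π.map_smul _ v)
      (fun v => ((LinearMap.ker π).subtype.comp g).map_smul _ v)
      (fun v => ((LinearMap.ker π).subtype.comp g).map_smul _ v)
      hπ ?_ ?_ (EIP_use hE1) hXM hYM ?_
    · ext v
      constructor
      · rintro ⟨w, rfl⟩
        exact (g w).2
      · intro hv
        obtain ⟨w, hw⟩ := hg ⟨v, hv⟩
        exact ⟨w, congrArg Subtype.val hw⟩
    · intro v hv
      rw [mem_rr]
      exact mem_mA_smul v (hmin hv)
    · intro n hn
      have hn' : n ∈ LinearMap.ker g := Subtype.ext hn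
      obtain ⟨m', h⟩ := EIP_use hN (e.symm ⟨n, hn'⟩)
      have h2 := congrArg e h
      rw [map_smul, map_smul, LinearEquiv.apply_symm_apply] at h2
      exact ⟨(e m').1, congrArg Subtype.val h2⟩
  · rintro N _ _ ⟨r, t, f, g, h, hf, hex, hh, hker, hess, -⟩ hN
    apply key
    refine part2 (K := k) hp3 q_ge _ _ _ _ (opr M (xA k p)) (opr M (yA k p))
      (FL_pi r) (FL_pi t) (f.restrictScalars k) (g.restrictScalars k)
      (fun v => f.map_smul _ v) (fun v => f.map_smul _ v)
      (fun v => g.map_smul _ v) (fun v => g.map_smul _ v)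
      hf ?_ ?_ (EIP_use hE1) hXM hYM ?_
    · ext v
      exact SetLike.ext_iff.mp hex v
    · rintro v ⟨hx, hy⟩
      have hx' : xA k p • v = 0 := hx
      have hy' : yA k p • v = 0 := hy
      change v ∈ LinearMap.range f
      by_contra hv
      have := hess (Submodule.span _ {v}) (by
        rw [eq_bot_iff]
        rintro w ⟨hw1, hw2⟩
        obtain ⟨a, rfl⟩ := Submodule.mem_span_singleton.mp hw1
        obtain ⟨c, a1, a2, rfl⟩ := const_decomp a
        have e1 : (algebraMap k (Amod k p) c + xA k p * a1 + yA k p * a2) • v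
            = algebraMap k (Amod k p) c • v := by
          rw [add_smul, add_smul, mul_comm _ a1, mul_comm _ a2, mul_smul, mul_smul, hx', hy']
          simp
        have hw2' : (algebraMap k (Amod k p) c + xA k p * a1 + yA k p * a2) • v
          ∈ LinearMap.range f := hw2
        rw [e1] at hw2' ⊢
        by_cases hc : c = 0
        · rw [hc, map_zero]
          have : (0 : Amod k p) • v = 0 := zero_smul (Amod k p) v
          exact this ▸ Submodule.zero_mem _
        · exfalso
          apply hv
          have := (LinearMap.range f).smul_mem (algebraMap k (Amod k p) c⁻¹) hw2'
          rw [smul_smul, ← map_mul, inv_mul_cancel₀ hc, map_one, one_smul] at this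
          exact this)
      rw [Submodule.span_singleton_eq_bot] at this
      exact hv (this ▸ Submodule.zero_mem _)
    · intro v
      obtain ⟨m', hm⟩ := EIP_use hN (h v)
      obtain ⟨w, rfl⟩ := hh m'
      have h3 : yA k p • v - xA k p • w ∈ LinearMap.ker h := by
        rw [LinearMap.mem_ker, map_sub, map_smul, map_smul, hm, sub_self]
      rw [hker] at h3
      obtain ⟨l, hl⟩ := h3
      refine ⟨w, l, ?_⟩
      change yA k p • v = xA k p • w + g l
      rw [hl]; abel

end
end

section
/- Let 2 ≤ d ≤ p−1 and n ≥ d. Then every minimal second syzygy of W_{n,d} has constant Jordan type ⊕_{i=1}^{d−1} [i] ⊕ (n−d+1)[d] ⊕ (n−d+1)p·[p]. -/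
open MvPolynomial Module

set_option maxHeartbeats 1000000
set_option synthInstance.maxHeartbeats 400000

noncomputable section

variable (k : Type) [Field k] (p : ℕ)

/-- The standard basis vector `v_i` of the free module `A^n`. -/
def stdV (n : ℕ) (i : Fin n) : Fin n → Amod k p := Pi.single i 1

/-- The set of defining relations of the module `W_{n,d}` inside the free module `A^n`
(indices of `v_1, …, v_n` are `0, …, n-1`): `x·v_1`, `y·v_n`, `x^d·v_i` for `2 ≤ i ≤ n`,
and `y·v_i − x·v_{i+1}` for `1 ≤ i ≤ n−1`. -/
def NSet (n d : ℕ) : Set (Fin n → Amod k p) :=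
  (⋃ (i : Fin n) (_ : i.val = 0), {xA k p • stdV k p n i}) ∪
  (⋃ (i : Fin n) (_ : i.val = n - 1), {yA k p • stdV k p n i}) ∪
  (⋃ (i : Fin n) (_ : i.val ≠ 0), {(xA k p) ^ d • stdV k p n i}) ∪
  (⋃ (i : Fin n) (j : Fin n) (_ : j.val = i.val + 1),
    {yA k p • stdV k p n i - xA k p • stdV k p n j})

/-- The submodule `N_{n,d} ⊆ A^n` of defining relations of `W_{n,d}`. -/
def NSub (n d : ℕ) : Submodule (Amod k p) (Fin n → Amod k p) :=
  Submodule.span (Amod k p) (NSet k p n d)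

/-- The module `W_{n,d} = A^n / N_{n,d}`. -/
abbrev Wmod (n d : ℕ) : Type := (Fin n → Amod k p) ⧸ NSub k p n d

/-- `M` has constant Jordan type `⊕ a_i [i]`: for every point operator `u`, the nilpotent
operator `u_M` has exactly `a i` Jordan blocks of size `i` (`1 ≤ i ≤ p`), expressed through
ranks: `rank(u_M^j) = Σ_{i=j+1}^p (i−j)·a i` for `1 ≤ j ≤ p−1` and
`dim_k M = Σ_{i=1}^p i·a i`. -/
def ConstantJordanType (a : ℕ → ℕ) (M : Type) [AddCommGroup M] [Module (Amod k p) M]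
    [Module k M] [IsScalarTower k (Amod k p) M] : Prop :=
  finrank k M = ∑ i ∈ Finset.Icc 1 p, i * a i ∧
  ∀ u : Amod k p, IsPointOp k p u → ∀ j : ℕ, 1 ≤ j → j ≤ p - 1 →
    finrank k (↥(LinearMap.range ((LinearMap.lsmul (Amod k p) M u) ^ j)))
      = ∑ i ∈ Finset.Icc (j + 1) p, (i - j) * a i

/-- `M` is an indecomposable `A`-module: it is nonzero and admits no nontrivial internal
direct sum decomposition. -/
def IsIndecomposableMod (M : Type) [AddCommGroup M] [Module (Amod k p) M] : Prop :=
  Nontrivial M ∧ ∀ N N' : Submodule (Amod k p) M, IsCompl N N' → N = ⊥ ∨ N' = ⊥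

namespace SyzW

/-- the exponent vector `(a,b)` -/
def mm (a b : ℕ) : Fin 2 →₀ ℕ := Finsupp.single 0 a + Finsupp.single 1 b

lemma mm_zero (a b : ℕ) : mm a b 0 = a := by simp [mm]
lemma mm_one (a b : ℕ) : mm a b 1 = b := by simp [mm]

lemma mm_surj (m : Fin 2 →₀ ℕ) : m = mm (m 0) (m 1) := by
  ext i; fin_cases i <;> simp [mm]

lemma mm_inj {a b a' b' : ℕ} : mm a b = mm a' b' ↔ a = a' ∧ b = b' := by
  constructor
  · intro h
    have h0 := DFunLike.congr_fun h 0
    have h1 := DFunLike.congr_fun h 1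
    rw [mm_zero, mm_zero] at h0
    rw [mm_one, mm_one] at h1
    exact ⟨h0, h1⟩
  · rintro ⟨rfl, rfl⟩; rfl

variable {k p}

lemma coeff_relI {a b : ℕ} (ha : a < p) (hb : b < p) {q : MvPolynomial (Fin 2) k}
    (hq : q ∈ relI k p) : coeff (mm a b) q = 0 := by
  have h : relI k p = Ideal.span ((fun s => monomial s (1 : k)) '' {mm p 0, mm 0 p}) := by
    rw [relI, Set.image_pair]
    simp [mm, X_pow_eq_monomial]
  rw [h, mem_ideal_span_monomial_image] at hq
  by_contra hne
  obtain ⟨s, hs, hle⟩ := hq (mm a b) (mem_support_iff.2 hne)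
  rcases hs with rfl | rfl
  · have := hle 0
    rw [mm_zero, mm_zero] at this; omega
  · have := hle 1
    rw [mm_one, mm_one] at this; omega

variable (k p)

open Classical in
/-- the coefficient functional of `x^a y^b` on `A` (zero unless `a, b < p`) -/
def cf (a b : ℕ) : Amod k p →ₗ[k] k :=
  if h : a < p ∧ b < p then
    (((relI k p).restrictScalars k).liftQ (lcoeff k (mm a b))
      (fun _ hq => coeff_relI h.1 h.2 hq)).comp
      (Submodule.Quotient.restrictScalarsEquiv k (relI k p)).symm.toLinearMap
  else 0

variable {k p}

lemma cf_mk {a b : ℕ} (ha : a < p) (hb : b < p) (q : MvPolynomial (Fin 2) k) :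
    cf k p a b (Ideal.Quotient.mk (relI k p) q) = coeff (mm a b) q := by
  rw [cf, dif_pos ⟨ha, hb⟩]; rfl

lemma cf_x_mul {a b : ℕ} (ha : a < p) (hb : b < p) (f : Amod k p) :
    cf k p a b (xA k p * f) = if a = 0 then 0 else cf k p (a - 1) b f := by
  obtain ⟨q, rfl⟩ := Ideal.Quotient.mk_surjective f
  rw [xA, ← map_mul, cf_mk ha hb, cf_mk (by omega) hb, coeff_X_mul']
  by_cases h : a = 0
  · simp [h, mm]
  · have h2 : mm a b - Finsupp.single 0 1 = mm (a - 1) b := by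
      ext i; fin_cases i <;> simp [mm]
    rw [if_neg h, if_pos, h2]
    rw [Finsupp.mem_support_iff, mm_zero]; exact h

lemma cf_y_mul {a b : ℕ} (ha : a < p) (hb : b < p) (f : Amod k p) :
    cf k p a b (yA k p * f) = if b = 0 then 0 else cf k p a (b - 1) f := by
  obtain ⟨q, rfl⟩ := Ideal.Quotient.mk_surjective f
  rw [yA, ← map_mul, cf_mk ha hb, cf_mk ha (by omega), coeff_X_mul']
  by_cases h : b = 0
  · simp [h, mm]
  · have h2 : mm a b - Finsupp.single 1 1 = mm a (b - 1) := by
      ext i; fin_cases i <;> simp [mm]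
    rw [if_neg h, if_pos, h2]
    rw [Finsupp.mem_support_iff, mm_one]; exact h

lemma cf_xpow_mul {a b : ℕ} (ha : a < p) (hb : b < p) (e : ℕ) (f : Amod k p) :
    cf k p a b (xA k p ^ e * f) = if a < e then 0 else cf k p (a - e) b f := by
  induction e generalizing a with
  | zero => simp
  | succ e ih =>
    rw [pow_succ', mul_assoc, cf_x_mul ha hb, ih (by omega)]
    by_cases h0 : a = 0
    · simp [h0]
    · rw [if_neg h0]
      by_cases h1 : a < e + 1
      · rw [if_pos h1, if_pos (by omega)]
      · rw [if_neg h1, if_neg (by omega), show a - 1 - e = a - (e + 1) by omega]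

lemma cf_one {a b : ℕ} (ha : a < p) (hb : b < p) :
    cf k p a b 1 = if a = 0 ∧ b = 0 then 1 else 0 := by
  rw [← map_one (Ideal.Quotient.mk (relI k p)), cf_mk ha hb, coeff_one]
  have : (0 : Fin 2 →₀ ℕ) = mm 0 0 := by simp [mm]
  rw [this]
  simp only [mm_inj, eq_comm]

lemma cf_monomial {a b : ℕ} (ha : a < p) (hb : b < p) (e f : ℕ) :
    cf k p a b (xA k p ^ e * yA k p ^ f) = if a = e ∧ b = f then 1 else 0 := by
  have : xA k p ^ e * yA k p ^ f = Ideal.Quotient.mk (relI k p) (monomial (mm e f) 1) := by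
    rw [xA, yA, ← map_pow, ← map_pow, ← map_mul, X_pow_eq_monomial, X_pow_eq_monomial,
      monomial_mul, one_mul]; rfl
  rw [this, cf_mk ha hb, coeff_monomial]
  simp only [mm_inj, eq_comm]

lemma xA_pow : xA k p ^ p = 0 := by
  rw [xA, ← map_pow, Ideal.Quotient.eq_zero_iff_mem]
  exact Ideal.subset_span (by simp)

lemma yA_pow : yA k p ^ p = 0 := by
  rw [yA, ← map_pow, Ideal.Quotient.eq_zero_iff_mem]
  exact Ideal.subset_span (by simp)

lemma mem_mA_of_cf (hp : 0 < p) (f : Amod k p) (h : cf k p 0 0 f = 0) : f ∈ mA k p := by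
  obtain ⟨q, rfl⟩ := Ideal.Quotient.mk_surjective f
  have key : ∀ q : MvPolynomial (Fin 2) k, ∃ s : k,
      Ideal.Quotient.mk (relI k p) q - algebraMap k _ s ∈ mA k p := by
    intro q
    induction q using MvPolynomial.induction_on with
    | C a => exact ⟨a, by
        have : Ideal.Quotient.mk (relI k p) (C a) = algebraMap k _ a := rfl
        rw [this, sub_self]; exact zero_mem _⟩
    | add q r hq hr =>
      obtain ⟨s, hs⟩ := hq
      obtain ⟨t, ht⟩ := hr
      refine ⟨s + t, ?_⟩
      have := add_mem hs ht
      rw [map_add, map_add]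
      convert this using 1; ring
    | mul_X q i hq =>
      refine ⟨0, ?_⟩
      rw [map_zero, sub_zero, map_mul]
      apply Ideal.mul_mem_left
      fin_cases i
      · exact Ideal.subset_span (by simp [xA])
      · exact Ideal.subset_span (by simp [yA])
  have hm : ∀ g ∈ mA k p, cf k p 0 0 g = 0 := by
    intro g hg
    rw [mA, Ideal.mem_span_pair] at hg
    obtain ⟨a, b, rfl⟩ := hg
    rw [map_add, mul_comm a, mul_comm b, cf_x_mul hp hp, cf_y_mul hp hp]; simp
  obtain ⟨s, hs⟩ := key q
  have h2 := hm _ hs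
  rw [map_sub, h, Algebra.algebraMap_eq_smul_one, map_smul, cf_one hp hp] at h2
  simp at h2
  rw [h2, map_zero, sub_zero] at hs
  exact hs

lemma induct_A {P : Amod k p → Prop} (hC : ∀ s : k, P (algebraMap k _ s))
    (hadd : ∀ f g, P f → P g → P (f + g)) (hx : ∀ f, P f → P (xA k p * f))
    (hy : ∀ f, P f → P (yA k p * f)) (f : Amod k p) : P f := by
  obtain ⟨q, rfl⟩ := Ideal.Quotient.mk_surjective f
  induction q using MvPolynomial.induction_on with
  | C a => exact hC a
  | add q r hq hr => rw [map_add]; exact hadd _ _ hq hr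
  | mul_X q i hq =>
    rw [map_mul, mul_comm]
    fin_cases i
    · exact hx _ hq
    · exact hy _ hq

lemma spanA_aux (u z : Amod k p) (hu : u ^ p = 0) (hz : z ^ p = 0)
    (h : ∃ a b c d : k, xA k p = a • u + b • z ∧ yA k p = c • u + d • z) :
    Submodule.span k (Set.range fun t : Fin p × Fin p => u ^ t.1.val * z ^ t.2.val) = ⊤ := by
  set S := Submodule.span k (Set.range fun t : Fin p × Fin p => u ^ t.1.val * z ^ t.2.val)
  have hall : ∀ a b : ℕ, u ^ a * z ^ b ∈ S := by
    intro a b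
    by_cases ha : a < p
    · by_cases hb : b < p
      · exact Submodule.subset_span ⟨(⟨a, ha⟩, ⟨b, hb⟩), rfl⟩
      · rw [pow_eq_zero_of_le (not_lt.1 hb) hz, mul_zero]; exact zero_mem _
    · rw [pow_eq_zero_of_le (not_lt.1 ha) hu, zero_mul]; exact zero_mem _
  have hu' : ∀ f ∈ S, u * f ∈ S := by
    intro f hf
    induction hf using Submodule.span_induction with
    | mem f hf =>
      obtain ⟨t, rfl⟩ := hf
      have := hall (t.1.val + 1) t.2.val
      rwa [pow_succ', mul_assoc] at this
    | zero => rw [mul_zero]; exact zero_mem _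
    | add f g _ _ hf hg => rw [mul_add]; exact add_mem hf hg
    | smul c f _ hf => rw [mul_smul_comm]; exact S.smul_mem _ hf
  have hz' : ∀ f ∈ S, z * f ∈ S := by
    intro f hf
    induction hf using Submodule.span_induction with
    | mem f hf =>
      obtain ⟨t, rfl⟩ := hf
      have := hall t.1.val (t.2.val + 1)
      rwa [pow_succ', mul_left_comm] at this
    | zero => rw [mul_zero]; exact zero_mem _
    | add f g _ _ hf hg => rw [mul_add]; exact add_mem hf hg
    | smul c f _ hf => rw [mul_smul_comm]; exact S.smul_mem _ hf
  obtain ⟨a, b, c, d, hx, hy⟩ := h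
  rw [eq_top_iff]
  rintro f -
  refine induct_A (P := fun f => f ∈ S) ?_ ?_ ?_ ?_ f
  · intro s
    rw [Algebra.algebraMap_eq_smul_one]
    apply S.smul_mem
    simpa using hall 0 0
  · exact fun f g => add_mem
  · intro f hf
    rw [hx, add_mul, smul_mul_assoc, smul_mul_assoc]
    exact add_mem (S.smul_mem _ (hu' f hf)) (S.smul_mem _ (hz' f hf))
  · intro f hf
    rw [hy, add_mul, smul_mul_assoc, smul_mul_assoc]
    exact add_mem (S.smul_mem _ (hu' f hf)) (S.smul_mem _ (hz' f hf))

lemma spanA_xy :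
    Submodule.span k (Set.range fun t : Fin p × Fin p => xA k p ^ t.1.val * yA k p ^ t.2.val)
      = ⊤ :=
  spanA_aux _ _ xA_pow yA_pow ⟨1, 0, 0, 1, by simp, by simp⟩

instance finA : Module.Finite k (Amod k p) :=
  ⟨by rw [← spanA_xy]; exact Submodule.fg_span (Set.finite_range _)⟩

lemma indepA : LinearIndependent k
    (fun t : Fin p × Fin p => xA k p ^ t.1.val * yA k p ^ t.2.val) := by
  rw [Fintype.linearIndependent_iff]
  intro g hg t
  have := congrArg (cf k p t.1.val t.2.val) hg
  rw [map_sum, map_zero] at this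
  simp only [map_smul, cf_monomial t.1.2 t.2.2] at this
  rw [Finset.sum_eq_single t] at this
  · simpa using this
  · intro b _ hb
    rw [if_neg, smul_zero]
    rintro ⟨h1, h2⟩
    exact hb (Prod.ext (Fin.ext h1.symm) (Fin.ext h2.symm))
  · simp

lemma finrankA : finrank k (Amod k p) = p * p := by
  have := finrank_span_eq_card (indepA (k := k) (p := p))
  rw [spanA_xy, finrank_top] at this
  simpa using this

/-- every point operator has a complementary coordinate -/
lemma pointOp_compl [Fact p.Prime] [CharP k p] {u : Amod k p} (hu : IsPointOp k p u) :
    u ^ p = 0 ∧ ∃ z : Amod k p, z ^ p = 0 ∧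
    ∃ a b c d : k, xA k p = a • u + b • z ∧ yA k p = c • u + d • z := by
  obtain ⟨α, β, h, rfl⟩ := hu
  have : CharP (Amod k p) p := by
    have : Nontrivial (Amod k p) := by
      have := finrankA (k := k) (p := p)
      refine Module.nontrivial_of_finrank_pos (R := k) ?_
      rw [this]
      have := (Fact.out : p.Prime).pos
      positivity
    exact charP_of_injective_algebraMap (algebraMap k (Amod k p)).injective p
  constructor
  · rw [add_pow_char]
    rw [smul_pow, smul_pow, xA_pow, yA_pow]; simp
  · by_cases hα : α = 0
    · have hβ : β ≠ 0 := by tauto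
      refine ⟨xA k p, xA_pow, 0, 1, β⁻¹, 0, by simp, ?_⟩
      simp [hα, smul_smul, inv_mul_cancel₀ hβ]
    · refine ⟨yA k p, yA_pow, α⁻¹, - (α⁻¹ * β), 0, 1, ?_, by simp⟩
      rw [smul_add, smul_smul, smul_smul, inv_mul_cancel₀ hα, one_smul, neg_smul]
      abel

/-- rank of `u^j` on `A`, and exactness -/
lemma rank_ge [Fact p.Prime] [CharP k p] {u : Amod k p} (hu : IsPointOp k p u) {j : ℕ}
    (hj : j ≤ p) : p * (p - j) ≤ finrank k (LinearMap.range (LinearMap.mulLeft k (u ^ j))) := by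
  obtain ⟨hup, z, hz, h⟩ := pointOp_compl hu
  have hs := spanA_aux u z hup hz h
  have hi : LinearIndependent k (fun t : Fin p × Fin p => u ^ t.1.val * z ^ t.2.val) := by
    apply linearIndependent_of_top_le_span_of_card_eq_finrank hs.ge
    rw [finrankA]; simp
  let e : Fin (p - j) × Fin p → Fin p × Fin p := fun t => (⟨t.1.val + j, by omega⟩, t.2)
  have he : Function.Injective e := by
    rintro ⟨a, b⟩ ⟨c, d⟩ h
    simp only [e, Prod.mk.injEq, Fin.mk.injEq, Nat.add_right_cancel_iff] at h
    exact Prod.ext (Fin.ext h.1) h.2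
  have hi2 := hi.comp e he
  have hc := finrank_span_eq_card hi2
  rw [Fintype.card_prod, Fintype.card_fin, Fintype.card_fin] at hc
  rw [mul_comm, ← hc]
  apply Submodule.finrank_mono
  rw [Submodule.span_le]
  rintro _ ⟨t, rfl⟩
  refine ⟨u ^ t.1.val * z ^ t.2.val, ?_⟩
  simp only [LinearMap.mulLeft_apply, Function.comp, e, pow_add]
  ring

lemma rank_and_exact [Fact p.Prime] [CharP k p] {u : Amod k p} (hu : IsPointOp k p u) {j : ℕ}
    (hj : j ≤ p) :
    finrank k (LinearMap.range (LinearMap.mulLeft k (u ^ j))) = p * (p - j) ∧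
    ∀ f : Amod k p, u ^ j * f = 0 → ∃ g, f = u ^ (p - j) * g := by
  have h1 := rank_ge hu hj
  have h2 := rank_ge hu (Nat.sub_le p j)
  have h3 := LinearMap.finrank_range_add_finrank_ker (LinearMap.mulLeft k (u ^ j))
  have hle : LinearMap.range (LinearMap.mulLeft k (u ^ (p - j))) ≤
      LinearMap.ker (LinearMap.mulLeft k (u ^ j)) := by
    rintro _ ⟨f, rfl⟩
    rw [LinearMap.mem_ker, LinearMap.mulLeft_apply, LinearMap.mulLeft_apply, ← mul_assoc,
      ← pow_add, show j + (p - j) = p by omega, (pointOp_compl hu).1, zero_mul]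
  have h4 := Submodule.finrank_mono hle
  rw [finrankA] at h3
  have h5 : p * (p - j) + p * (p - (p - j)) = p * p := by
    rw [← mul_add]; congr 1; omega
  refine ⟨by omega, fun f hf => ?_⟩
  have heq := Submodule.eq_of_le_of_finrank_le hle (by omega)
  have : f ∈ LinearMap.ker (LinearMap.mulLeft k (u ^ j)) := hf
  rw [← heq] at this
  obtain ⟨g, hg⟩ := this
  exact ⟨g, hg.symm⟩

section general
variable {k : Type} [Field k] {p : ℕ}

/-- rank over `k` of multiplication by `a` -/
def rk (M : Type) [AddCommGroup M] [Module (Amod k p) M]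
    [Module k M] [IsScalarTower k (Amod k p) M] (a : Amod k p) : ℕ :=
  finrank k (LinearMap.range (LinearMap.lsmul (Amod k p) M a))

lemma rk_equiv {M M' : Type} [AddCommGroup M] [Module (Amod k p) M]
    [Module k M] [IsScalarTower k (Amod k p) M] [AddCommGroup M'] [Module (Amod k p) M']
    [Module k M'] [IsScalarTower k (Amod k p) M'] (e : M ≃ₗ[Amod k p] M') (a : Amod k p) :
    rk (k := k) M a = rk (k := k) M' a := by
  have h : (LinearMap.range (LinearMap.lsmul (Amod k p) M a)).map e.toLinearMap
      = LinearMap.range (LinearMap.lsmul (Amod k p) M' a) := by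
    ext m
    constructor
    · rintro ⟨_, ⟨w, rfl⟩, rfl⟩
      exact ⟨e w, by simp⟩
    · rintro ⟨w, rfl⟩
      exact ⟨a • e.symm w, ⟨e.symm w, rfl⟩, by simp⟩
  unfold rk
  rw [← h]
  exact ((e.submoduleMap _).restrictScalars k).finrank_eq

lemma rk_pi (ι : Type) [Fintype ι] (a : Amod k p) :
    rk (k := k) (ι → Amod k p) a
      = Fintype.card ι * finrank k (LinearMap.range (LinearMap.mulLeft k a)) := by
  have h : finrank k (ι → LinearMap.range (LinearMap.mulLeft k a))
      = Fintype.card ι * finrank k (LinearMap.range (LinearMap.mulLeft k a)) := by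
    rw [Module.finrank_pi_fintype]; simp
  rw [← h]
  symm
  let T : (ι → LinearMap.range (LinearMap.mulLeft k a)) →ₗ[k]
      LinearMap.range (LinearMap.lsmul (Amod k p) (ι → Amod k p) a) :=
    { toFun := fun f => ⟨fun i => (f i).1, by
        choose g hg using fun i => (f i).2
        exact ⟨g, funext hg⟩⟩
      map_add' := fun _ _ => rfl
      map_smul' := fun _ _ => rfl }
  refine (LinearEquiv.ofBijective T ⟨?_, ?_⟩).finrank_eq
  · intro f g h
    funext i
    exact Subtype.ext (congrFun (congrArg Subtype.val h) i)
  · rintro ⟨_, ⟨g, rfl⟩⟩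
    exact ⟨fun i => ⟨a * g i, ⟨g i, rfl⟩⟩, rfl⟩

lemma rk_ker {F M : Type} [AddCommGroup F] [Module (Amod k p) F]
    [Module k F] [IsScalarTower k (Amod k p) F] [AddCommGroup M] [Module (Amod k p) M]
    [Module k M] [IsScalarTower k (Amod k p) M] [Module.Finite k F]
    (g : F →ₗ[Amod k p] M) (hg : Function.Surjective g) (a b : Amod k p) (hab : a * b = 0)
    (hex : ∀ f : F, a • f = 0 → ∃ h, f = b • h) :
    rk (k := k) (LinearMap.ker g) a + rk (k := k) F b
      = finrank k (LinearMap.ker g) + rk (k := k) M b := by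
  let K := LinearMap.ker g
  let T : K →ₗ[k] K := (LinearMap.lsmul (Amod k p) K a).restrictScalars k
  let B := LinearMap.range (LinearMap.lsmul (Amod k p) F b)
  let S : B →ₗ[k] M := (g.comp B.subtype).restrictScalars k
  have : Module.Finite k K := Module.Finite.of_injective
    (K.subtype.restrictScalars k) Subtype.val_injective
  have : Module.Finite k B := Module.Finite.of_injective
    (B.subtype.restrictScalars k) Subtype.val_injective
  have h1 := LinearMap.finrank_range_add_finrank_ker T
  have h2 := LinearMap.finrank_range_add_finrank_ker S
  have h3 : LinearMap.range S
      = LinearMap.range ((LinearMap.lsmul (Amod k p) M b).restrictScalars k) := by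
    ext m
    constructor
    · rintro ⟨⟨_, ⟨w, rfl⟩⟩, rfl⟩
      exact ⟨g w, by simp [S]⟩
    · rintro ⟨m, rfl⟩
      obtain ⟨w, rfl⟩ := hg m
      exact ⟨⟨b • w, ⟨w, rfl⟩⟩, by simp [S]⟩
  have h4 : (LinearMap.ker T).map (K.subtype.restrictScalars k)
      = (LinearMap.ker S).map (B.subtype.restrictScalars k) := by
    ext f
    constructor
    · rintro ⟨⟨f, hf⟩, hk, rfl⟩
      have hk' : a • f = 0 := congrArg Subtype.val hk
      obtain ⟨h, rfl⟩ := hex f hk'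
      exact ⟨⟨b • h, ⟨h, rfl⟩⟩, hf, rfl⟩
    · rintro ⟨⟨_, ⟨w, rfl⟩⟩, hk, rfl⟩
      have hk' : g (b • w) = 0 := hk
      refine ⟨⟨b • w, hk'⟩, ?_, rfl⟩
      apply Subtype.ext
      change a • b • w = 0
      rw [smul_smul, hab]
      exact zero_smul (Amod k p) w
  have h5 : finrank k (LinearMap.ker T) = finrank k (LinearMap.ker S) := by
    rw [(Submodule.equivMapOfInjective (K.subtype.restrictScalars k)
      Subtype.val_injective (LinearMap.ker T)).finrank_eq, h4]
    exact (Submodule.equivMapOfInjective (B.subtype.restrictScalars k)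
      Subtype.val_injective (LinearMap.ker S)).finrank_eq.symm
  rw [h3] at h2
  have e1 : rk (k := k) K a = finrank k (LinearMap.range T) := rfl
  have e2 : rk (k := k) M b
    = finrank k (LinearMap.range ((LinearMap.lsmul (Amod k p) M b).restrictScalars k)) := rfl
  have e3 : rk (k := k) F b = finrank k B := rfl
  change rk (k := k) K a + rk (k := k) F b = finrank k K + rk (k := k) M b
  omega

lemma mA_le_jac : mA k p ≤ Ideal.jacobson ⊥ := by
  rw [mA, Ideal.span_le]
  have hn : ∀ f : Amod k p, f ^ p = 0 → f ∈ Ideal.jacobson (⊥ : Ideal (Amod k p)) := by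
    intro f hf
    apply Ideal.radical_le_jacobson
    exact ⟨p, by rw [hf]; exact zero_mem _⟩
  rintro f (rfl | rfl)
  · exact hn _ xA_pow
  · exact hn _ yA_pow

lemma exists_lift {ι κ : Type} [Finite ι] [Finite κ] {M : Type} [AddCommGroup M]
    [Module (Amod k p) M]
    (f : (ι → Amod k p) →ₗ[Amod k p] M) (g : (κ → Amod k p) →ₗ[Amod k p] M)
    (hf : Function.Surjective f) (hg : Function.Surjective g)
    (hk : LinearMap.ker g ≤ mA k p • (⊤ : Submodule (Amod k p) (κ → Amod k p))) :
    ∃ φ : (ι → Amod k p) →ₗ[Amod k p] (κ → Amod k p), g.comp φ = f ∧ Function.Surjective φ := by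
  obtain ⟨φ, hφ⟩ := Module.projective_lifting_property g f hg
  refine ⟨φ, hφ, ?_⟩
  rw [← LinearMap.range_eq_top, eq_top_iff]
  apply Submodule.le_of_le_smul_of_le_jacobson_bot (I := mA k p) Module.Finite.fg_top mA_le_jac
  rintro w -
  obtain ⟨v, hv⟩ := hf (g w)
  have : w - φ v ∈ LinearMap.ker g := by
    rw [LinearMap.mem_ker, map_sub, ← LinearMap.comp_apply, hφ, hv, sub_self]
  have h2 := Submodule.add_mem_sup (LinearMap.mem_range_self φ v) (hk this)
  simpa using h2

lemma card_unique [Nontrivial (Amod k p)] {ι κ : Type} [Fintype ι] [Fintype κ] {M : Type}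
    [AddCommGroup M] [Module (Amod k p) M]
    (f : (ι → Amod k p) →ₗ[Amod k p] M) (g : (κ → Amod k p) →ₗ[Amod k p] M)
    (hf : Function.Surjective f) (hg : Function.Surjective g)
    (hkf : LinearMap.ker f ≤ mA k p • (⊤ : Submodule (Amod k p) (ι → Amod k p)))
    (hk : LinearMap.ker g ≤ mA k p • (⊤ : Submodule (Amod k p) (κ → Amod k p))) :
    Fintype.card ι = Fintype.card κ := by
  obtain ⟨φ, -, hφ⟩ := exists_lift f g hf hg hk
  obtain ⟨ψ, -, hψ⟩ := exists_lift g f hg hf hkf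
  exact le_antisymm (card_le_of_surjective (Amod k p) ψ hψ)
    (card_le_of_surjective (Amod k p) φ hφ)

lemma mem_mA_smul_top {ι : Type} [Fintype ι] (f : ι → Amod k p) (hf : ∀ i, f i ∈ mA k p) :
    f ∈ mA k p • (⊤ : Submodule (Amod k p) (ι → Amod k p)) := by
  classical
  rw [pi_eq_sum_univ f]
  exact sum_mem fun i _ => Submodule.smul_mem_smul (hf i) trivial

end general

section modW
variable (k : Type) [Field k] (p : ℕ)

/-- basis vectors indexed by natural numbers, zero out of range -/
def ev (n i : ℕ) : Fin n → Amod k p := if h : i < n then stdV k p n ⟨i, h⟩ else 0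

/-- the linear relations -/
def RR (n t : ℕ) : Fin n → Amod k p :=
  (if t = 0 then 0 else yA k p • ev k p n (t - 1)) - xA k p • ev k p n t

/-- functional picking the coefficient of `x^l v_i` -/
def lam (n l i : ℕ) (hi : i < n) : (Fin n → Amod k p) →ₗ[k] k :=
  ∑ b ∈ Finset.range (l + 1), (cf k p (l - b) b).comp
    (LinearMap.proj (⟨i - b, by omega⟩ : Fin n))

/-- minimal generators of `N_{n,d}` -/
def GG (n d : ℕ) : Fin (n + 1) ⊕ Fin (n - d) → (Fin n → Amod k p)
  | Sum.inl t => RR k p n t.val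
  | Sum.inr s => xA k p ^ d • ev k p n (d + s.val)

variable {k p}

lemma ev_ge {n i : ℕ} (h : n ≤ i) : ev k p n i = 0 := by
  rw [ev, dif_neg (by omega)]

lemma ev_apply {n i : ℕ} (j : Fin n) : ev k p n i j = if i = j.val then 1 else 0 := by
  unfold ev
  split_ifs with h h1 h1
  · subst h1; simp [stdV]
  · simp only [stdV]
    rw [Pi.single_eq_of_ne]
    intro h2; exact h1 (by rw [h2])
  · omega
  · rfl

lemma lam_ev {n l i : ℕ} (hl : l ≤ i) (hi : i < n) (a : Amod k p) (j : ℕ) :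
    lam k p n l i hi (a • ev k p n j)
      = if j ≤ i ∧ i - j ≤ l then cf k p (l - (i - j)) (i - j) a else 0 := by
  rw [lam, LinearMap.sum_apply]
  simp only [LinearMap.comp_apply, LinearMap.proj_apply, Pi.smul_apply, ev_apply, smul_eq_mul]
  split_ifs with h
  · rw [Finset.sum_eq_single (i - j)]
    · rw [if_pos (by omega), mul_one]
    · intro b hb hne
      rw [Finset.mem_range] at hb
      rw [if_neg (by omega), mul_zero, map_zero]
    · intro hb
      rw [Finset.mem_range] at hb
      omega
  · apply Finset.sum_eq_zero
    intro b hb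
    rw [Finset.mem_range] at hb
    rw [if_neg (by omega), mul_zero, map_zero]

lemma lam_RR {n l i : ℕ} (hl : l ≤ i) (hi : i < n) (hp : l < p) (a : Amod k p) (t : ℕ) :
    lam k p n l i hi (a • RR k p n t) = 0 := by
  unfold RR
  rcases t with _ | s
  · rw [if_pos rfl, zero_sub, smul_neg, map_neg, smul_smul, lam_ev hl, neg_eq_zero]
    split_ifs with h
    · rw [mul_comm, cf_x_mul (by omega) (by omega), if_pos (by omega)]
    · rfl
  · rw [if_neg (by omega), smul_sub, map_sub, smul_smul, smul_smul, lam_ev hl, lam_ev hl,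
      Nat.add_sub_cancel, mul_comm a, mul_comm a]
    by_cases h1 : s + 1 ≤ i
    · by_cases h2 : i - s ≤ l
      · rw [if_pos (by omega), if_pos (by omega), cf_y_mul (by omega) (by omega),
          cf_x_mul (by omega) (by omega), if_neg (by omega), if_neg (by omega),
          show l - (i - (s + 1)) - 1 = l - (i - s) by omega,
          show i - s - 1 = i - (s + 1) by omega, sub_self]
      · rw [if_neg (by omega)]
        split_ifs with h
        · rw [cf_x_mul (by omega) (by omega), if_pos (by omega), sub_self]
        · rw [sub_self]
    · rw [if_neg (show ¬ (s + 1 ≤ i ∧ i - (s + 1) ≤ l) by omega), sub_zero]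
      split_ifs with h
      · rw [cf_y_mul (by omega) (by omega), if_pos (by omega)]
      · rfl

lemma xpow_ev_mem {n : ℕ} (P : Submodule (Amod k p) (Fin n → Amod k p))
    (hR : ∀ t, RR k p n t ∈ P) (i : ℕ) : ∀ l, i < l → xA k p ^ l • ev k p n i ∈ P := by
  induction i with
  | zero =>
    intro l hl
    obtain ⟨m, rfl⟩ : ∃ m, l = m + 1 := ⟨l - 1, by omega⟩
    have h := hR 0
    rw [RR, if_pos rfl, zero_sub, neg_mem_iff] at h
    rw [pow_succ, ← smul_smul]
    exact P.smul_mem _ h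
  | succ i ih =>
    intro l hl
    obtain ⟨m, rfl⟩ : ∃ m, l = m + 1 := ⟨l - 1, by omega⟩
    have h := hR (i + 1)
    rw [RR, if_neg (by omega), Nat.add_sub_cancel] at h
    have h2 := P.smul_mem (xA k p ^ m) h
    have h3 := P.smul_mem (yA k p) (ih m (by omega))
    have h4 := sub_mem h3 h2
    convert h4 using 1
    rw [smul_sub, smul_smul, smul_smul, smul_smul, mul_comm (yA k p), pow_succ]
    abel

lemma RR_gt {n t : ℕ} (h : n < t) : RR k p n t = 0 := by
  rw [RR, if_neg (by omega), ev_ge (by omega), ev_ge (by omega)]; simp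

lemma RR_mem {n d : ℕ} (hn : 0 < n) (t : ℕ) : RR k p n t ∈ NSub k p n d := by
  by_cases ht : n < t
  · rw [RR_gt ht]; exact zero_mem _
  · rcases t with _ | s
    · rw [RR, if_pos rfl, zero_sub, neg_mem_iff, ev, dif_pos hn]
      apply Submodule.subset_span
      refine Or.inl (Or.inl (Or.inl ?_))
      simp only [Set.mem_iUnion, Set.mem_singleton_iff]
      exact ⟨⟨0, hn⟩, rfl, rfl⟩
    · rw [RR, if_neg (by omega), Nat.add_sub_cancel]
      by_cases hs : s + 1 < n
      · apply Submodule.subset_span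
        refine Or.inr ?_
        simp only [Set.mem_iUnion, Set.mem_singleton_iff]
        refine ⟨⟨s, by omega⟩, ⟨s + 1, hs⟩, rfl, ?_⟩
        rw [ev, dif_pos (by omega), ev, dif_pos hs]
      · rw [ev_ge (i := s + 1) (by omega), smul_zero, sub_zero]
        apply Submodule.subset_span
        refine Or.inl (Or.inl (Or.inr ?_))
        simp only [Set.mem_iUnion, Set.mem_singleton_iff]
        refine ⟨⟨s, by omega⟩, by simp only; omega, ?_⟩
        rw [ev, dif_pos (by omega)]

lemma xd_mem {n d i : ℕ} (hi : i ≠ 0) : xA k p ^ d • ev k p n i ∈ NSub k p n d := by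
  by_cases h : i < n
  · apply Submodule.subset_span
    refine Or.inl (Or.inr ?_)
    simp only [Set.mem_iUnion, Set.mem_singleton_iff]
    refine ⟨⟨i, h⟩, hi, ?_⟩
    rw [ev, dif_pos h]
  · rw [ev_ge (by omega), smul_zero]; exact zero_mem _

lemma NSub_eq {n d : ℕ} (hn : 0 < n) (hd : 0 < d) :
    NSub k p n d = Submodule.span (Amod k p) (Set.range (GG k p n d)) := by
  apply le_antisymm
  · have hR : ∀ t, RR k p n t ∈ Submodule.span (Amod k p) (Set.range (GG k p n d)) := by
      intro t
      by_cases ht : n < t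
      · rw [RR_gt ht]; exact zero_mem _
      · exact Submodule.subset_span ⟨Sum.inl ⟨t, by omega⟩, rfl⟩
    rw [NSub, Submodule.span_le]
    rintro f (((hf | hf) | hf) | hf)
    · simp only [Set.mem_iUnion, Set.mem_singleton_iff] at hf
      obtain ⟨i, hi, rfl⟩ := hf
      have h := hR 0
      rw [RR, if_pos rfl, zero_sub, neg_mem_iff, ev, dif_pos hn] at h
      have : i = ⟨0, hn⟩ := Fin.ext hi
      rw [this]; exact h
    · simp only [Set.mem_iUnion, Set.mem_singleton_iff] at hf
      obtain ⟨i, hi, rfl⟩ := hf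
      have h := hR n
      rw [RR, if_neg (by omega), ev_ge (le_refl n), smul_zero, sub_zero, ev,
        dif_pos (by omega)] at h
      have : i = ⟨n - 1, by omega⟩ := Fin.ext hi
      rw [this]; exact h
    · simp only [Set.mem_iUnion, Set.mem_singleton_iff] at hf
      obtain ⟨i, hi, rfl⟩ := hf
      have he : stdV k p n i = ev k p n i.val := by rw [ev, dif_pos i.2]
      rw [he]
      by_cases h : i.val < d
      · exact xpow_ev_mem _ hR _ _ h
      · refine Submodule.subset_span ⟨Sum.inr ⟨i.val - d, by omega⟩, ?_⟩
        simp only [GG]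
        rw [show d + (i.val - d) = i.val by omega]
    · simp only [Set.mem_iUnion, Set.mem_singleton_iff] at hf
      obtain ⟨i, j, hj, rfl⟩ := hf
      have h := hR (i.val + 1)
      rw [RR, if_neg (by omega), Nat.add_sub_cancel, ev, dif_pos i.2, ev,
        dif_pos (by omega)] at h
      have : j = ⟨i.val + 1, by omega⟩ := Fin.ext hj
      rw [this]; exact h
  · rw [Submodule.span_le]
    rintro _ ⟨t | s, rfl⟩
    · exact RR_mem hn _
    · exact xd_mem (by omega)

lemma lam_NSub {n d l i : ℕ} (hl : l ≤ i) (hi : i < n) (hld : l < d) (hp : l < p)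
    {f : Fin n → Amod k p} (hf : f ∈ NSub k p n d) : lam k p n l i hi f = 0 := by
  rw [NSub_eq (by omega) (by omega)] at hf
  have key : ∀ a : Amod k p, lam k p n l i hi (a • f) = 0 := by
    induction hf using Submodule.span_induction with
    | mem f hf =>
      intro a
      obtain ⟨t | s, rfl⟩ := hf
      · exact lam_RR hl hi hp a _
      · simp only [GG]
        rw [smul_smul, lam_ev hl]
        split_ifs with h
        · rw [mul_comm, cf_xpow_mul (by omega) (by omega), if_pos (by omega)]
        · rfl
    | zero => intro a; rw [smul_zero, map_zero]
    | add f g _ _ hf hg => intro a; rw [smul_add, map_add, hf, hg, add_zero]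
    | smul c f _ hf => intro a; rw [smul_smul]; exact hf _
  simpa using key 1

lemma NSub_le {n d : ℕ} (hn : 0 < n) (hd : 0 < d) :
    NSub k p n d ≤ mA k p • (⊤ : Submodule (Amod k p) (Fin n → Amod k p)) := by
  have hx : xA k p ∈ mA k p := Ideal.subset_span (by simp)
  have hy : yA k p ∈ mA k p := Ideal.subset_span (by simp)
  rw [NSub_eq hn hd, Submodule.span_le]
  rintro _ ⟨t | s, rfl⟩
  · simp only [GG, RR]
    apply sub_mem
    · split_ifs
      · exact zero_mem _
      · exact Submodule.smul_mem_smul hy trivial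
    · exact Submodule.smul_mem_smul hx trivial
  · exact Submodule.smul_mem_smul (Ideal.pow_mem_of_mem _ hx _ hd) trivial

/-- the generators are minimal -/
lemma GG_min {n d : ℕ} (hd : 2 ≤ d) (hdp : d < p) (hn : d ≤ n)
    (c : Fin (n + 1) ⊕ Fin (n - d) → Amod k p)
    (hc : ∑ t, c t • GG k p n d t = 0) : ∀ t, c t ∈ mA k p := by
  rw [Fintype.sum_sum_type] at hc
  simp only [GG] at hc
  have hp : 0 < p := by omega
  rintro (t | s)
  · apply mem_mA_of_cf hp
    have hj : ∀ j : Fin n,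
        cf k p 0 1 ((∑ t : Fin (n + 1), c (Sum.inl t) • RR k p n t.val) j) = 0 ∧
        cf k p 1 0 ((∑ t : Fin (n + 1), c (Sum.inl t) • RR k p n t.val) j) = 0 := by
      intro j
      have h := congrFun hc j
      have h2 : ∀ a b : ℕ, a < d → a < p → b < p →
          cf k p a b ((∑ s : Fin (n - d), c (Sum.inr s) • xA k p ^ d • ev k p n (d + s.val)) j)
            = 0 := by
        intro a b ha hap hb
        rw [Finset.sum_apply, map_sum]
        apply Finset.sum_eq_zero
        intro s _
        rw [Pi.smul_apply, Pi.smul_apply, smul_eq_mul, smul_eq_mul, mul_left_comm,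
          cf_xpow_mul hap hb, if_pos ha]
      rw [Pi.add_apply] at h
      constructor
      · have h3 := congrArg (cf k p 0 1) h
        rw [map_add, h2 0 1 (by omega) (by omega) (by omega), add_zero] at h3
        rw [h3]; exact map_zero _
      · have h3 := congrArg (cf k p 1 0) h
        rw [map_add, h2 1 0 (by omega) (by omega) (by omega), add_zero] at h3
        rw [h3]; exact map_zero _
    have hyx : ∀ (a b : ℕ) (_ : a < p) (_ : b < p) (j : Fin n) (t : Fin (n + 1)),
        cf k p a b ((c (Sum.inl t) • RR k p n t.val) j)
        = (if t.val = j.val + 1 then (if b = 0 then 0 else cf k p a (b - 1) (c (Sum.inl t)))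
            else 0)
          - (if t.val = j.val then (if a = 0 then 0 else cf k p (a - 1) b (c (Sum.inl t)))
            else 0) := by
      intro a b ha hb j t
      rw [Pi.smul_apply, RR, Pi.sub_apply, smul_eq_mul, mul_sub, map_sub]
      congr 1
      · by_cases h0 : t.val = 0
        · rw [if_pos h0, if_neg (by omega)]; simp
        · rw [if_neg h0, Pi.smul_apply, ev_apply, smul_eq_mul]
          by_cases h1 : t.val = j.val + 1
          · rw [if_pos h1, if_pos (by omega), mul_one, mul_comm, cf_y_mul ha hb]
          · rw [if_neg h1, if_neg (by omega)]; simp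
      · rw [Pi.smul_apply, ev_apply, smul_eq_mul]
        by_cases h1 : t.val = j.val
        · rw [if_pos h1, if_pos h1, mul_one, mul_comm, cf_x_mul ha hb]
        · rw [if_neg h1, if_neg h1]; simp
    by_cases ht : t.val = 0
    · have h := (hj ⟨0, by omega⟩).2
      rw [Finset.sum_apply, map_sum, Finset.sum_eq_single t] at h
      · rw [hyx 1 0 (by omega) hp] at h
        rw [if_neg (by simp only; omega), if_pos ht] at h
        simpa using h
      · intro b _ hb
        have : b.val ≠ 0 := fun h => hb (Fin.ext (by omega))
        rw [hyx 1 0 (by omega) hp, if_neg (show ¬ b.val = (0 : ℕ) from this)]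
        simp
      · simp
    · have h := (hj ⟨t.val - 1, by omega⟩).1
      rw [Finset.sum_apply, map_sum, Finset.sum_eq_single t] at h
      · rw [hyx 0 1 hp (by omega)] at h
        rw [if_pos (by simp only; omega)] at h
        simpa using h
      · intro b _ hb
        have : b.val ≠ t.val := fun h => hb (Fin.ext (by omega))
        rw [hyx 0 1 hp (by omega), if_neg (by simp only; omega)]
        simp
      · simp
  · apply mem_mA_of_cf hp
    have hi : d + s.val < n := by omega
    have h := congrArg (lam k p n d (d + s.val) hi) hc
    rw [map_add, map_sum, map_sum, map_zero,
      Finset.sum_eq_zero (fun t _ => lam_RR (by omega) hi hdp _ _), zero_add,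
      Finset.sum_eq_single s] at h
    · rw [smul_smul, lam_ev (by omega), if_pos (by omega), mul_comm,
        cf_xpow_mul (by omega) (by omega), if_neg (by omega)] at h
      simpa using h
    · intro b _ hb
      have : b.val ≠ s.val := fun h => hb (Fin.ext (by omega))
      rw [smul_smul, lam_ev (by omega)]
      split_ifs with h1
      · rw [mul_comm, cf_xpow_mul (by omega) (by omega), if_pos (by omega)]
      · rfl
    · simp

end modW

section rankW
variable {k : Type} [Field k] {p : ℕ}

variable (k p) in
/-- the class of `x^l v_i` in `W` -/
def ew (n d l i : ℕ) : Wmod k p n d := (NSub k p n d).mkQ (xA k p ^ l • ev k p n i)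

lemma x_ew (n d l i : ℕ) : xA k p • ew k p n d l i = ew k p n d (l + 1) i := by
  rw [ew, ew, ← map_smul, smul_smul, pow_succ']

lemma y_ew {n d : ℕ} (hn : 0 < n) (l i : ℕ) :
    yA k p • ew k p n d l i = ew k p n d (l + 1) (i + 1) := by
  rw [ew, ew, ← map_smul, ← sub_eq_zero, ← map_sub, ← LinearMap.mem_ker, Submodule.ker_mkQ]
  have h := (NSub k p n d).smul_mem (xA k p ^ l) (RR_mem (k := k) (p := p) (d := d) hn (i + 1))
  rw [RR, if_neg (by omega), Nat.add_sub_cancel] at h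
  convert h using 1
  rw [smul_sub, smul_smul, smul_smul, smul_smul, mul_comm (yA k p), pow_succ]

lemma ew_zero {n d l i : ℕ} (hn : 0 < n) (h : i < l ∨ n ≤ i ∨ d ≤ l) (hd : 0 < d) :
    ew k p n d l i = 0 := by
  rw [ew, ← LinearMap.mem_ker, Submodule.ker_mkQ]
  by_cases h1 : i < l
  · exact xpow_ev_mem _ (RR_mem hn) _ _ h1
  · rcases h with h | h | h
    · omega
    · rw [ev_ge h, smul_zero]; exact zero_mem _
    · obtain ⟨m, rfl⟩ := Nat.exists_eq_add_of_le' h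
      rw [pow_add, ← smul_smul]
      exact Submodule.smul_mem _ _ (xd_mem (by omega))

variable (k p) in
/-- span of the classes `x^l v_i`, `l ≥ j` -/
def SS (n d j : ℕ) : Submodule k (Wmod k p n d) :=
  Submodule.span k {w | ∃ l i, j ≤ l ∧ w = ew k p n d l i}

lemma ew_mem {n d j l : ℕ} (h : j ≤ l) (i : ℕ) : ew k p n d l i ∈ SS k p n d j :=
  Submodule.subset_span ⟨l, i, h, rfl⟩

lemma x_SS {n d j : ℕ} (w : Wmod k p n d) (hw : w ∈ SS k p n d j) :
    xA k p • w ∈ SS k p n d (j + 1) := by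
  induction hw using Submodule.span_induction with
  | mem w hw =>
    obtain ⟨l, i, h, rfl⟩ := hw
    rw [x_ew]; exact ew_mem (by omega) i
  | zero => rw [smul_zero]; exact zero_mem _
  | add f g _ _ hf hg => rw [smul_add]; exact add_mem hf hg
  | smul c f _ hf => rw [smul_comm]; exact Submodule.smul_mem _ _ hf

lemma y_SS {n d j : ℕ} (hn : 0 < n) (w : Wmod k p n d) (hw : w ∈ SS k p n d j) :
    yA k p • w ∈ SS k p n d (j + 1) := by
  induction hw using Submodule.span_induction with
  | mem w hw =>
    obtain ⟨l, i, h, rfl⟩ := hw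
    rw [y_ew hn]; exact ew_mem (by omega) _
  | zero => rw [smul_zero]; exact zero_mem _
  | add f g _ _ hf hg => rw [smul_add]; exact add_mem hf hg
  | smul c f _ hf => rw [smul_comm]; exact Submodule.smul_mem _ _ hf

lemma SS_anti {n d i j : ℕ} (h : i ≤ j) : SS k p n d j ≤ SS k p n d i := by
  apply Submodule.span_mono
  rintro w ⟨l, i', hl, rfl⟩
  exact ⟨l, i', by omega, rfl⟩

lemma SS_zero {n d : ℕ} (hn : 0 < n) : SS k p n d 0 = ⊤ := by
  rw [eq_top_iff]
  have hA : ∀ (a : Amod k p) (w : Wmod k p n d), w ∈ SS k p n d 0 → a • w ∈ SS k p n d 0 := by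
    intro a
    refine induct_A (P := fun a => ∀ w : Wmod k p n d, w ∈ SS k p n d 0 → a • w ∈ SS k p n d 0)
      ?_ ?_ ?_ ?_ a
    · intro s w hw
      rw [algebraMap_smul]; exact Submodule.smul_mem _ _ hw
    · intro f g hf hg w hw
      rw [add_smul]; exact add_mem (hf w hw) (hg w hw)
    · intro f hf w hw
      rw [← smul_smul]; exact SS_anti (Nat.zero_le _) (x_SS _ (hf w hw))
    · intro f hf w hw
      rw [← smul_smul]; exact SS_anti (Nat.zero_le _) (y_SS hn _ (hf w hw))
  rintro w -
  obtain ⟨f, rfl⟩ := (NSub k p n d).mkQ_surjective w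
  have : f = ∑ i : Fin n, f i • ev k p n i.val := by
    funext j
    rw [Finset.sum_apply, Finset.sum_eq_single j]
    · rw [Pi.smul_apply, ev_apply, if_pos rfl, smul_eq_mul, mul_one]
    · intro b _ hb
      rw [Pi.smul_apply, ev_apply, if_neg (fun h => hb (Fin.ext h)), smul_zero]
    · simp
  rw [this, map_sum]
  apply sum_mem
  intro i _
  rw [map_smul]
  apply hA
  have := ew_mem (k := k) (p := p) (n := n) (d := d) (le_refl 0) i.val
  rwa [ew, pow_zero, one_smul] at this

lemma SS_succ {n d : ℕ} (hn : 0 < n) (hd : 0 < d) {u : Amod k p} (hu : IsPointOp k p u) (j : ℕ) :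
    (SS k p n d j).map ((LinearMap.lsmul (Amod k p) (Wmod k p n d) u).restrictScalars k)
      = SS k p n d (j + 1) := by
  obtain ⟨α, β, hab, rfl⟩ := hu
  set T := (LinearMap.lsmul (Amod k p) (Wmod k p n d)
    (α • xA k p + β • yA k p)).restrictScalars k with hT
  have hTw : ∀ w, T w = α • xA k p • w + β • yA k p • w := by
    intro w
    rw [hT]
    simp [add_smul]
  apply le_antisymm
  · rintro _ ⟨w, hw, rfl⟩
    rw [hTw]
    exact add_mem (Submodule.smul_mem _ _ (x_SS _ hw)) (Submodule.smul_mem _ _ (y_SS hn _ hw))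
  · unfold SS
    rw [Submodule.span_le]
    rintro _ ⟨l', i, hl', rfl⟩
    obtain ⟨l, rfl⟩ : ∃ l, l' = l + 1 := ⟨l' - 1, by omega⟩
    have hTe : ∀ i, α • ew k p n d (l + 1) i + β • ew k p n d (l + 1) (i + 1)
        ∈ (SS k p n d j).map T := by
      intro i
      refine ⟨ew k p n d l i, ew_mem (by omega) i, ?_⟩
      rw [hTw, x_ew, y_ew hn]
    change ew k p n d (l + 1) i ∈ (SS k p n d j).map T
    by_cases hα : α = 0
    · have hβ : β ≠ 0 := by tauto
      rcases i with _ | i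
      · rw [ew_zero hn (by omega) hd]; exact zero_mem _
      · have := hTe i
        rw [hα, zero_smul, zero_add] at this
        exact (Submodule.smul_mem_iff _ hβ).1 this
    · have key : ∀ m i, n ≤ i + m → ew k p n d (l + 1) i ∈ (SS k p n d j).map T := by
        intro m
        induction m with
        | zero => intro i hi; rw [ew_zero hn (by omega) hd]; exact zero_mem _
        | succ m ih =>
          intro i hi
          have h1 := hTe i
          have h2 := Submodule.smul_mem _ β (ih (i + 1) (by omega))
          have h3 := sub_mem h1 h2
          rw [add_sub_cancel_right] at h3
          exact (Submodule.smul_mem_iff _ hα).1 h3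
      exact key n i (by omega)

lemma SS_range {n d : ℕ} (hn : 0 < n) (hd : 0 < d) {u : Amod k p} (hu : IsPointOp k p u) (j : ℕ) :
    LinearMap.range ((LinearMap.lsmul (Amod k p) (Wmod k p n d) (u ^ j)).restrictScalars k)
      = SS k p n d j := by
  induction j with
  | zero =>
    rw [SS_zero hn, LinearMap.range_eq_top]
    intro w
    exact ⟨w, by simp⟩
  | succ j ih =>
    have h : (LinearMap.lsmul (Amod k p) (Wmod k p n d) (u ^ (j + 1))).restrictScalars k
        = ((LinearMap.lsmul (Amod k p) (Wmod k p n d) u).restrictScalars k).comp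
          ((LinearMap.lsmul (Amod k p) (Wmod k p n d) (u ^ j)).restrictScalars k) := by
      refine LinearMap.ext fun w => ?_
      change u ^ (j + 1) • w = u • u ^ j • w
      rw [pow_succ']
      exact mul_smul u (u ^ j) w
    rw [h, LinearMap.range_comp, ih, SS_succ hn hd hu]

lemma SS_finrank {n d : ℕ} (hn : 0 < n) (hd : 0 < d) (hdp : d ≤ p) (j : ℕ) :
    finrank k (SS k p n d j) = ∑ l ∈ Finset.Ico j d, (n - l) := by
  let T : Finset (Σ _ : ℕ, ℕ) := (Finset.Ico j d).sigma (fun l => Finset.Ico l n)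
  have hT : ∀ t : T, (j ≤ t.1.1 ∧ t.1.1 < d) ∧ (t.1.1 ≤ t.1.2 ∧ t.1.2 < n) := by
    intro t
    have := t.2
    simpa only [T, Finset.mem_sigma, Finset.mem_Ico] using this
  have hspan : SS k p n d j
      = Submodule.span k (Set.range fun t : T => ew k p n d t.1.1 t.1.2) := by
    apply le_antisymm
    · unfold SS
      rw [Submodule.span_le]
      rintro _ ⟨l, i, hl, rfl⟩
      by_cases h : i < l ∨ n ≤ i ∨ d ≤ l
      · rw [ew_zero hn h hd]; exact zero_mem _
      · refine Submodule.subset_span ⟨⟨⟨l, i⟩, ?_⟩, rfl⟩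
        simp only [T, Finset.mem_sigma, Finset.mem_Ico]
        omega
    · rw [Submodule.span_le]
      rintro _ ⟨t, rfl⟩
      exact ew_mem (hT t).1.1 _
  have hli : LinearIndependent k (fun t : T => ew k p n d t.1.1 t.1.2) := by
    rw [Fintype.linearIndependent_iff]
    intro g hg t
    have h1 : ∑ s : T, g s • (xA k p ^ s.1.1 • ev k p n s.1.2) ∈ NSub k p n d := by
      rw [← Submodule.ker_mkQ (NSub k p n d), LinearMap.mem_ker, map_sum, ← hg]
      rfl
    obtain ⟨⟨ha, hb⟩, hc, he⟩ := hT t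
    have h2 := lam_NSub hc he hb (by omega) h1
    rw [map_sum, Finset.sum_eq_single t] at h2
    · rw [map_smul, lam_ev hc, if_pos (by omega), ← mul_one (xA k p ^ _),
        cf_xpow_mul (by omega) (by omega), if_neg (by omega), cf_one (by omega) (by omega),
        if_pos (by omega)] at h2
      simpa using h2
    · intro s _ hs
      rw [map_smul, lam_ev hc]
      split_ifs with h
      · rw [← mul_one (xA k p ^ _), cf_xpow_mul (by omega) (by omega)]
        split_ifs with h3
        · rw [smul_zero]
        · rw [cf_one (by omega) (by omega), if_neg, smul_zero]
          intro h4
          apply hs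
          apply Subtype.ext
          have e1 : s.1.1 = t.1.1 := by omega
          have e2 : s.1.2 = t.1.2 := by omega
          exact Sigma.ext e1 (heq_of_eq e2)
      · rw [smul_zero]
    · simp
  rw [hspan, finrank_span_eq_card hli, Fintype.card_coe, Finset.card_sigma]
  simp

lemma rk_W {n d : ℕ} (hn : 0 < n) (hd : 0 < d) (hdp : d ≤ p) {u : Amod k p}
    (hu : IsPointOp k p u) (j : ℕ) :
    rk (k := k) (Wmod k p n d) (u ^ j) = ∑ l ∈ Finset.Ico j d, (n - l) := by
  rw [← SS_finrank (k := k) hn hd hdp j, ← SS_range hn hd hu]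
  rfl

end rankW

section final
variable {k : Type} [Field k] {p : ℕ}

lemma rk_one {M : Type} [AddCommGroup M] [Module (Amod k p) M]
    [Module k M] [IsScalarTower k (Amod k p) M] : rk (k := k) (p := p) M 1 = finrank k M := by
  have h : LinearMap.range ((LinearMap.lsmul (Amod k p) M 1).restrictScalars k) = ⊤ := by
    rw [LinearMap.range_eq_top]
    intro w
    exact ⟨w, by simp⟩
  have : rk (k := k) (p := p) M 1
    = finrank k (LinearMap.range ((LinearMap.lsmul (Amod k p) M 1).restrictScalars k)) := rfl
  rw [this, h, finrank_top]

lemma lsmul_pow {M : Type} [AddCommGroup M] [Module (Amod k p) M] (u : Amod k p) (j : ℕ) :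
    (LinearMap.lsmul (Amod k p) M u) ^ j = LinearMap.lsmul (Amod k p) M (u ^ j) := by
  induction j with
  | zero => ext; simp
  | succ j ih => rw [pow_succ', ih]; ext w; simp [pow_succ', smul_smul, mul_comm]

lemma sum_formula {d n : ℕ} (hd2 : 2 ≤ d) (hdp : d ≤ p - 1) (hn : d ≤ n) (j : ℕ)
    (hj : j ≤ p - 1) :
    ∑ i ∈ Finset.Icc (j + 1) p, (i - j) * (if 1 ≤ i ∧ i ≤ d - 1 then 1
        else if i = d then n - d + 1
        else if i = p then (n - d + 1) * p
        else 0)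
    = (p - j) * ((n - d + 1) * p) + ∑ l ∈ Finset.Ico j d, (n - l) := by
  set a : ℕ → ℕ := fun i => if 1 ≤ i ∧ i ≤ d - 1 then 1
        else if i = d then n - d + 1
        else if i = p then (n - d + 1) * p
        else 0 with ha
  change ∑ i ∈ Finset.Icc (j + 1) p, (i - j) * a i = _
  have h1 : Finset.Icc (j + 1) p = Finset.Ico (j + 1) (p + 1) := by ext; simp
  have hap : a p = (n - d + 1) * p := by
    simp only [ha]; rw [if_neg (by omega), if_neg (by omega)]; simp
  rw [h1, Finset.sum_Ico_succ_top (by omega), hap, add_comm]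
  congr 1
  -- remaining: sum over Ico (j+1) p
  have key : ∀ m j, j + m = p - 1 → ∑ i ∈ Finset.Ico (j + 1) p, (i - j) * a i
      = ∑ l ∈ Finset.Ico j d, (n - l) ∧ ∑ i ∈ Finset.Ico (j + 1) p, a i
      = if d ≤ j then 0 else n - j := by
    intro m
    induction m with
    | zero =>
      intro j hj
      rw [Finset.Ico_eq_empty (by omega), Finset.Ico_eq_empty (by omega), if_pos (by omega)]
      simp
    | succ m ih =>
      intro j hj
      obtain ⟨i1, i2⟩ := ih (j + 1) (by omega)
      have hcount : ∑ i ∈ Finset.Ico (j + 1) p, a i = if d ≤ j then 0 else n - j := by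
        rw [Finset.sum_eq_sum_Ico_succ_bot (by omega), i2]
        simp only [ha]
        split_ifs <;> omega
      refine ⟨?_, hcount⟩
      have hs : ∑ i ∈ Finset.Ico (j + 1) p, (i - j) * a i
          = ∑ i ∈ Finset.Ico (j + 1) p, (i - (j + 1)) * a i
            + ∑ i ∈ Finset.Ico (j + 1) p, a i := by
        rw [← Finset.sum_add_distrib]
        apply Finset.sum_congr rfl
        intro i hi
        rw [Finset.mem_Ico] at hi
        obtain ⟨q, rfl⟩ := Nat.exists_eq_add_of_le hi.1
        rw [show j + 1 + q - j = q + 1 by omega, show j + 1 + q - (j + 1) = q by omega]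
        ring
      rw [hs, hcount, Finset.sum_eq_sum_Ico_succ_bot (by omega), Nat.sub_self, zero_mul,
        zero_add, i1]
      by_cases hdj : d ≤ j
      · rw [if_pos hdj, Finset.Ico_eq_empty (by omega), Finset.Ico_eq_empty (by omega), add_zero]
      · rw [if_neg hdj, Finset.sum_eq_sum_Ico_succ_bot (b := d) (a := j) (by omega)]
        ring
  exact (key (p - 1 - j) j (by omega)).1

lemma arith_aux {p j d n s S X1 X2 X3 X4 : ℕ} (hj : j ≤ p) (hn : d ≤ n)
    (hs : s = n + 1 + (n - d)) (E1 : X1 + s * (p * j) = X3 + X2)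
    (E2 : X2 + n * (p * (p - j)) = X4 + S) (E3 : X4 + X3 = s * (p * p)) :
    X1 = (p - j) * ((n - d + 1) * p) + S := by
  obtain ⟨e, rfl⟩ := Nat.exists_eq_add_of_le hn
  obtain ⟨b, rfl⟩ := Nat.exists_eq_add_of_le hj
  rw [Nat.add_sub_cancel_left] at hs E2 ⊢
  rw [Nat.add_sub_cancel_left]
  subst hs
  zify at *
  linear_combination E1 + E2 + E3

lemma main_rank [Fact p.Prime] [CharP k p]
    (d n : ℕ) (hd2 : 2 ≤ d) (hdp : d ≤ p - 1) (hn : d ≤ n)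
    (r : ℕ) (g : (Fin r → Amod k p) →ₗ[Amod k p] Wmod k p n d) (hg : Function.Surjective g)
    (hgk : LinearMap.ker g ≤ mA k p • (⊤ : Submodule (Amod k p) (Fin r → Amod k p)))
    (s : ℕ) (h : (Fin s → Amod k p) →ₗ[Amod k p] LinearMap.ker g) (hh : Function.Surjective h)
    (hhk : LinearMap.ker h ≤ mA k p • (⊤ : Submodule (Amod k p) (Fin s → Amod k p)))
    {u : Amod k p} (hu : IsPointOp k p u) (j : ℕ) (hj : j ≤ p - 1) :
    rk (k := k) (LinearMap.ker h) (u ^ j)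
      = (p - j) * ((n - d + 1) * p) + ∑ l ∈ Finset.Ico j d, (n - l) := by
  have hpp : 0 < p := (Fact.out : p.Prime).pos
  have : Nontrivial (Amod k p) := by
    refine Module.nontrivial_of_finrank_pos (R := k) ?_
    rw [finrankA]; positivity
  -- the rank of the first free module
  have hπ := (NSub k p n d).mkQ_surjective
  have hπk : LinearMap.ker (NSub k p n d).mkQ
      ≤ mA k p • (⊤ : Submodule (Amod k p) (Fin n → Amod k p)) := by
    rw [Submodule.ker_mkQ]; exact NSub_le (by omega) (by omega)
  have hr : r = n := by
    have := card_unique g (NSub k p n d).mkQ hg hπ hgk hπk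
    simpa using this
  subst hr
  obtain ⟨φ, hφ, hφs⟩ := exists_lift g (NSub k p r d).mkQ hg hπ hπk
  have hφi : Function.Injective φ := OrzechProperty.injective_of_surjective_endomorphism φ hφs
  have hφm : ∀ f, f ∈ LinearMap.ker g ↔ φ f ∈ NSub k p r d := by
    intro f
    rw [LinearMap.mem_ker, ← hφ]
    exact Submodule.Quotient.mk_eq_zero _
  -- the rank of the second free module
  let h' : (Fin s → Amod k p) →ₗ[Amod k p] NSub k p r d :=
    ((φ.comp (LinearMap.ker g).subtype).comp h).codRestrict _ (fun f => (hφm _).1 (h f).2)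
  have hh' : Function.Surjective h' := by
    rintro ⟨w, hw⟩
    obtain ⟨v, rfl⟩ := hφs w
    obtain ⟨f, hf⟩ := hh ⟨v, (hφm v).2 hw⟩
    refine ⟨f, Subtype.ext ?_⟩
    change φ (h f).1 = φ v
    rw [hf]
  have hhk' : LinearMap.ker h' ≤ mA k p • (⊤ : Submodule (Amod k p) (Fin s → Amod k p)) := by
    refine le_trans ?_ hhk
    intro f hf
    have h1 : φ (h f).1 = 0 := congrArg Subtype.val hf
    rw [← map_zero φ] at h1
    exact Subtype.ext (hφi h1)
  have hGm : ∀ t, GG k p r d t ∈ NSub k p r d := by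
    intro t
    rw [NSub_eq (by omega) (by omega)]
    exact Submodule.subset_span ⟨t, rfl⟩
  let q : (Fin (r + 1) ⊕ Fin (r - d) → Amod k p) →ₗ[Amod k p] NSub k p r d :=
    (Fintype.linearCombination (Amod k p) (GG k p r d)).codRestrict _ (by
      intro c
      rw [Fintype.linearCombination_apply]
      exact sum_mem fun t _ => Submodule.smul_mem _ _ (hGm t))
  have hq : Function.Surjective q := by
    rintro ⟨w, hw⟩
    have hw' := hw
    rw [NSub_eq (by omega) (by omega), ← Fintype.range_linearCombination] at hw'
    obtain ⟨c, hc⟩ := hw'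
    exact ⟨c, Subtype.ext hc⟩
  have hqk : LinearMap.ker q
      ≤ mA k p • (⊤ : Submodule (Amod k p) (Fin (r + 1) ⊕ Fin (r - d) → Amod k p)) := by
    intro c hc
    apply mem_mA_smul_top
    apply GG_min hd2 (by omega) hn c
    have h1 : Fintype.linearCombination (Amod k p) (GG k p r d) c = 0 := congrArg Subtype.val hc
    rwa [Fintype.linearCombination_apply] at h1
  have hs : s = r + 1 + (r - d) := by
    have := card_unique h' q hh' hq hhk' hqk
    simpa using this
  -- ranks
  have hex : ∀ (m i : ℕ), i ≤ p → ∀ f : Fin m → Amod k p, u ^ i • f = 0 →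
      ∃ h, f = u ^ (p - i) • h := by
    intro m i hi f hf
    choose w hw using fun t => (rank_and_exact hu hi).2 (f t) (congrFun hf t)
    exact ⟨w, funext hw⟩
  have hmul : ∀ i, i ≤ p → u ^ i * u ^ (p - i) = 0 := by
    intro i hi
    rw [← pow_add, show i + (p - i) = p by omega, (pointOp_compl hu).1]
  have hfree : ∀ m i, i ≤ p → rk (k := k) (Fin m → Amod k p) (u ^ i) = m * (p * (p - i)) := by
    intro m i hi
    rw [rk_pi, (rank_and_exact hu hi).1, Fintype.card_fin]
  have hpj : p - (p - j) = j := by omega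
  have E1 := rk_ker h hh (u ^ j) (u ^ (p - j)) (hmul j (by omega)) (hex s j (by omega))
  have E2 := rk_ker g hg (u ^ (p - j)) (u ^ (p - (p - j))) (hmul (p - j) (by omega))
    (hex r (p - j) (by omega))
  rw [hpj] at E2
  have E3 := (h.restrictScalars k).finrank_range_add_finrank_ker
  rw [LinearMap.range_eq_top.2 (by exact hh), finrank_top] at E3
  change _ + finrank k (LinearMap.ker h) = _ at E3
  rw [Module.finrank_pi_fintype] at E3
  simp only [finrankA, Finset.sum_const, Finset.card_univ, Fintype.card_fin, smul_eq_mul] at E3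
  rw [hfree s (p - j) (by omega), hpj] at E1
  rw [hfree r j (by omega), rk_W (by omega) (by omega) (by omega) hu] at E2
  exact arith_aux (by omega) hn hs E1 E2 E3

end final
end SyzW

/-- for `2 ≤ d ≤ p−1` and `n ≥ d`, every minimal second syzygy of `W_{n,d}`
has constant Jordan type `⊕_{i=1}^{d−1}[i] ⊕ (n−d+1)[d] ⊕ (n−d+1)p·[p]`. -/
theorem minSecondSyz_W_constantJordanType
    [IsAlgClosed k] [Fact p.Prime] [CharP k p]
    (d n : ℕ) (hd2 : 2 ≤ d) (hdp : d ≤ p - 1) (hn : d ≤ n)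
    (N : Type) [AddCommGroup N] [Module (Amod k p) N]
    [Module k N] [IsScalarTower k (Amod k p) N] [FiniteDimensional k N]
    (hN : IsMinSyz k p 2 (ModuleCat.of (Amod k p) N) (ModuleCat.of (Amod k p) (Wmod k p n d))) :
    ConstantJordanType k p
      (fun i => if 1 ≤ i ∧ i ≤ d - 1 then 1
        else if i = d then n - d + 1
        else if i = p then (n - d + 1) * p
        else 0) N := by
  obtain ⟨r, g, hg, hgk, s, h, hh, hhk, ⟨e⟩⟩ := hN
  have key := fun {u : Amod k p} (hu : IsPointOp k p u) (j : ℕ) (hj : j ≤ p - 1) =>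
    (SyzW.rk_equiv (k := k) (M := N) (M' := LinearMap.ker h) e (u ^ j)).trans
      (SyzW.main_rank d n hd2 hdp hn r g hg hgk s h hh hhk hu j hj)
  constructor
  · have hx : IsPointOp k p (xA k p) := ⟨1, 0, by simp, by simp⟩
    have h0 := key hx 0 (by omega)
    rw [pow_zero, SyzW.rk_one, ← SyzW.sum_formula hd2 hdp hn 0 (by omega)] at h0
    exact h0
  · intro u hu j _ hj2
    rw [SyzW.lsmul_pow]
    exact (key hu j hj2).trans (SyzW.sum_formula hd2 hdp hn j hj2).symm

end
end
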